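/- arXiv:1506.01498 — 2 statements merged into one kernel-verified Lean document; each statement's English description precedes it below -/
import Mathlib

section
/- Let m, d, e, k satisfy e = gcd(m,d) = gcd(m,2d) and 2 ≤ k ≤ (m+e)/(2e), and let C be the Gold type code of relative dimension k. For each i = 0, ..., k-2 and ε = ±1, writing r = (m-e)/e - 2i, the number of nonzero codewords c ∈ C with DC(c) = -1 + ε·2^{(m+e)/2 + ei} equals α_{r,ε} = (1/2)(2^{er} + ε 2^{er/2}) · Σ_{j=i}^{k-2} (-1)^{j-i} 4^{e·binom(j-i,2)} (j choose i)_{4^e} ((m-e)/(2e) choose j)_{4^e} (2^{m(k-1-j)} - 1). -/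
open Finset
open scoped Classical

/-- The Gaussian (q-)binomial coefficient, defined via the q-Pascal recurrence. -/
def gaussBinom {R : Type*} [CommRing R] (q : R) : ℕ → ℕ → R
  | _, 0 => 1
  | 0, _ + 1 => 0
  | u + 1, i + 1 => gaussBinom q u i + q ^ (i + 1) * gaussBinom q u (i + 1)

/-! ### Gaussian binomial coefficients -/

section GaussBinom

variable {R : Type*} [CommRing R]

lemma gaussBinom_zero_right (b : R) (l : ℕ) : gaussBinom b l 0 = 1 := by
  cases l <;> rfl

lemma gaussBinom_succ_succ (b : R) (l j : ℕ) :
    gaussBinom b (l + 1) (j + 1) = gaussBinom b l j + b ^ (j + 1) * gaussBinom b l (j + 1) := rfl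

lemma gaussBinom_eq_zero_of_lt (b : R) {l j : ℕ} (h : l < j) : gaussBinom b l j = 0 := by
  induction l generalizing j with
  | zero => obtain ⟨j, rfl⟩ := Nat.exists_eq_succ_of_ne_zero h.ne'; rfl
  | succ l ih =>
    obtain ⟨j, rfl⟩ := Nat.exists_eq_succ_of_ne_zero (Nat.ne_zero_of_lt h)
    rw [Nat.succ_eq_add_one, gaussBinom_succ_succ, ih (by lia), ih (by lia)]
    simp

lemma gaussBinom_self (b : R) (l : ℕ) : gaussBinom b l l = 1 := by
  induction l with
  | zero => rfl
  | succ l ih => rw [gaussBinom_succ_succ, ih, gaussBinom_eq_zero_of_lt b (by lia)]; simp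

lemma prod_pow_succ_sub_pow (b : R) (l j : ℕ) :
    ∏ s ∈ range (j + 1), (b ^ (l + 1) - b ^ s) =
      (b ^ (l + 1) - 1) * b ^ j * ∏ s ∈ range j, (b ^ l - b ^ s) := by
  rw [prod_range_succ', pow_zero, mul_assoc, mul_comm]
  congr 1
  rw [← card_range j, ← prod_const, card_range, ← prod_mul_distrib]
  exact prod_congr rfl fun _ _ => by ring

lemma gaussBinom_mul_prod (b : R) (l j : ℕ) :
    gaussBinom b l j * ∏ s ∈ range j, (b ^ j - b ^ s) = ∏ s ∈ range j, (b ^ l - b ^ s) := by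
  induction l generalizing j with
  | zero =>
    cases j with
    | zero => simp [gaussBinom_zero_right]
    | succ j =>
      rw [gaussBinom_eq_zero_of_lt b (by lia), zero_mul, prod_range_succ']
      simp
  | succ l ih =>
    cases j with
    | zero => simp [gaussBinom_zero_right]
    | succ j =>
      have h1 := ih j
      have h2 := ih (j + 1)
      rw [prod_range_succ (fun s => b ^ l - b ^ s)] at h2
      rw [gaussBinom_succ_succ, add_mul, mul_assoc (b ^ (j + 1)), h2, prod_pow_succ_sub_pow b j j,
        prod_pow_succ_sub_pow b l j, ← h1]
      ring

/-- The alternating sum in the `q`-binomial theorem vanishes at `1`. -/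
lemma sum_neg_one_pow_mul_gaussBinom (b : R) {s : ℕ} (hs : s ≠ 0) :
    ∑ t ∈ range (s + 1), (-1) ^ t * b ^ (t.choose 2) * gaussBinom b s t = 0 := by
  obtain ⟨s, rfl⟩ := Nat.exists_eq_succ_of_ne_zero hs
  rw [Nat.succ_eq_add_one, sum_range_succ']
  have hch : ∀ t : ℕ, (t + 1).choose 2 = t.choose 2 + t := fun t => by
    rw [Nat.choose_succ_succ' t 1, Nat.choose_one_right, add_comm]
  have h1 : ∀ t ∈ range (s + 1), (-1 : R) ^ (t + 1) * b ^ ((t + 1).choose 2) *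
      gaussBinom b (s + 1) (t + 1) =
      (-1) ^ (t + 1) * b ^ ((t + 1).choose 2 + (t + 1)) * gaussBinom b s (t + 1) -
      (-1) ^ t * b ^ (t.choose 2 + t) * gaussBinom b s t := fun t _ => by
    rw [gaussBinom_succ_succ, hch]
    ring
  rw [sum_congr rfl h1,
    sum_range_sub fun t => (-1 : R) ^ t * b ^ (t.choose 2 + t) * gaussBinom b s t]
  simp [gaussBinom_zero_right, gaussBinom_eq_zero_of_lt]

end GaussBinom

section GaussBinomRat

variable {b : ℚ} (hb : 1 < b)

include hb in
lemma prod_pow_sub_pow_ne_zero {j l : ℕ} (h : j ≤ l) :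
    ∏ s ∈ range j, (b ^ l - b ^ s) ≠ 0 :=
  prod_ne_zero_iff.2 fun _ hs =>
    (sub_pos.2 (pow_lt_pow_right₀ hb ((mem_range.1 hs).trans_le h))).ne'

include hb in
lemma gaussBinom_pos {j l : ℕ} (h : j ≤ l) : 0 < gaussBinom b l j := by
  have hp : ∀ n, j ≤ n → 0 < ∏ s ∈ range j, (b ^ n - b ^ s) := fun n hn =>
    prod_pos fun s hs => sub_pos.2 (pow_lt_pow_right₀ hb ((mem_range.1 hs).trans_le hn))
  have := gaussBinom_mul_prod b l j
  exact pos_of_mul_pos_left (this ▸ hp l h) (hp j le_rfl).le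

include hb in
lemma gaussBinom_mul_gaussBinom (i s t : ℕ) :
    gaussBinom b (i + s) (i + t) * gaussBinom b (i + t) i =
      gaussBinom b (i + s) i * gaussBinom b s t := by
  have hsplit : ∀ n, ∏ r ∈ range (i + t), (b ^ (i + n) - b ^ r) =
      (∏ r ∈ range i, (b ^ (i + n) - b ^ r)) * (b ^ i) ^ t * ∏ r ∈ range t, (b ^ n - b ^ r) := by
    intro n
    rw [prod_range_add, mul_assoc]
    congr 1
    rw [← card_range t, ← prod_const, card_range, ← prod_mul_distrib]
    exact prod_congr rfl fun r _ => by ring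
  have hD := prod_pow_sub_pow_ne_zero hb (le_refl (i + t))
  have hD' := prod_pow_sub_pow_ne_zero hb (le_refl i)
  refine mul_right_cancel₀ hD (mul_right_cancel₀ hD' ?_)
  have h1 := gaussBinom_mul_prod b (i + s) (i + t)
  have h2 := gaussBinom_mul_prod b (i + t) i
  have h3 := gaussBinom_mul_prod b (i + s) i
  have h4 := gaussBinom_mul_prod b s t
  rw [hsplit s] at h1
  calc _ = (gaussBinom b (i + s) (i + t) * ∏ r ∈ range (i + t), (b ^ (i + t) - b ^ r)) *
        (gaussBinom b (i + t) i * ∏ r ∈ range i, (b ^ i - b ^ r)) := by ring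
    _ = _ := by
      rw [h1, h2, hsplit t, ← h3, ← h4]
      ring

include hb in
lemma sum_gaussBinom_orthogonality {i l M : ℕ} (hl : l ≤ M) :
    ∑ j ∈ Icc i M, (-1) ^ (j - i) * b ^ ((j - i).choose 2) * gaussBinom b j i *
      gaussBinom b l j = if l = i then 1 else 0 := by
  have hsub : ∑ j ∈ Icc i l, (-1) ^ (j - i) * b ^ ((j - i).choose 2) * gaussBinom b j i *
      gaussBinom b l j = ∑ j ∈ Icc i M, (-1) ^ (j - i) * b ^ ((j - i).choose 2) *
      gaussBinom b j i * gaussBinom b l j := by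
    refine sum_subset (Icc_subset_Icc_right hl) fun j hj hj' => ?_
    simp only [mem_Icc] at hj hj'
    rw [gaussBinom_eq_zero_of_lt b (by lia : l < j), mul_zero]
  rw [← hsub]
  rcases lt_or_ge l i with h | h
  · rw [Icc_eq_empty (by lia), sum_empty, if_neg (by lia)]
  obtain ⟨s, rfl⟩ := Nat.exists_eq_add_of_le h
  rw [← Ico_add_one_right_eq_Icc, sum_Ico_eq_sum_range]
  have hterm : ∀ t ∈ range (i + s + 1 - i), (-1 : ℚ) ^ (i + t - i) * b ^ ((i + t - i).choose 2) *
      gaussBinom b (i + t) i * gaussBinom b (i + s) (i + t) =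
      gaussBinom b (i + s) i * ((-1) ^ t * b ^ (t.choose 2) * gaussBinom b s t) := fun t _ => by
    rw [Nat.add_sub_cancel_left]
    linear_combination (-1 : ℚ) ^ t * b ^ (t.choose 2) * gaussBinom_mul_gaussBinom hb i s t
  rw [sum_congr rfl hterm, ← mul_sum, show i + s + 1 - i = s + 1 by lia]
  by_cases hs : s = 0
  · subst hs
    simp [gaussBinom_self]
  · rw [sum_neg_one_pow_mul_gaussBinom b hs, if_neg (by lia), mul_zero]

end GaussBinomRat

/-! ### The moment functional of the alternating forms -/

section MomentFunctional

open Polynomial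

/-- The moments of the number of elements of the radical of a uniformly random alternating form
on a space with `z⁻¹` elements over the field with `q` elements. -/
def altMoment (q : ℚ) : ℕ → ℚ → ℚ
  | 0, _ => 1
  | t + 1, z => altMoment q t z + q ^ (t + 1) * (1 - z) * altMoment q t (q * z)

lemma altMoment_succ (q z : ℚ) (t : ℕ) : altMoment q (t + 1) z =
    altMoment q t z + q ^ (t + 1) * (1 - z) * altMoment q t (q * z) := rfl

lemma altMoment_succ' {q : ℚ} (hq : q ≠ 0) (t : ℕ) (z : ℚ) :
    altMoment q (t + 1) z = (q ^ (t + 1))⁻¹ * altMoment q (t + 1) (q * z) +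
      (q ^ (t + 1) - (q ^ (t + 1))⁻¹) * altMoment q t (q * z) := by
  induction t generalizing z with
  | zero =>
    simp only [altMoment]
    field_simp
    ring
  | succ t ih =>
    have h1 := ih z
    have h2 := ih (q * z)
    have h3 := altMoment_succ q (q * z) t
    rw [altMoment_succ q z (t + 1), altMoment_succ q (q * z) (t + 1), h1]
    have e : (q ^ (t + 1 + 1))⁻¹ * q ^ (t + 1 + 1) = 1 := inv_mul_cancel₀ (pow_ne_zero _ hq)
    have e' : (q ^ (t + 1))⁻¹ * q ^ (t + 1) = 1 := inv_mul_cancel₀ (pow_ne_zero _ hq)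
    linear_combination -(1 - q * z) * altMoment q (t + 1) (q * (q * z)) * (e - e') +
      q ^ (t + 1) * (1 - q * z) * h2 - (q ^ (t + 1) - (q ^ (t + 1))⁻¹) * h3

/-- The linear functional on polynomials with moments `altMoment`. -/
noncomputable def altFunctional (q z : ℚ) : ℚ[X] →ₗ[ℚ] ℚ :=
  Polynomial.lsum fun t => altMoment q t z • LinearMap.id

lemma altFunctional_X_pow (q z : ℚ) (t : ℕ) :
    altFunctional q z (X ^ t) = altMoment q t z := by
  rw [X_pow_eq_monomial, altFunctional, lsum_apply, sum_monomial_index] <;> simp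

lemma altFunctional_sub_one_mul_comp {q : ℚ} (hq : q ≠ 0) (z : ℚ) (P : ℚ[X]) :
    altFunctional q z ((X - 1) * P.comp (C q⁻¹ * X)) =
      q * (1 - z) * altFunctional q (q * z) P := by
  induction P using Polynomial.induction_on' with
  | add P R hP hR => rw [add_comp, mul_add, map_add, map_add, hP, hR, mul_add]
  | monomial t c =>
    rw [← C_mul_X_pow_eq_monomial, ← smul_eq_C_mul, smul_comp, X_pow_comp, mul_pow, ← C_pow,
      ← smul_eq_C_mul, mul_smul_comm, mul_smul_comm, sub_mul, ← pow_succ', one_mul]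
    simp only [map_smul, map_sub, altFunctional_X_pow, altMoment_succ, smul_eq_mul]
    have e : q⁻¹ ^ t * q ^ t = 1 := by rw [← mul_pow, inv_mul_cancel₀ hq, one_pow]
    linear_combination c * q * (1 - z) * altMoment q t (q * z) * e

lemma divX_mul_X_eq (P : ℚ[X]) : divX (P * X) = P := by
  ext n
  rw [coeff_divX, coeff_mul_X]

lemma altFunctional_eq_divX {q : ℚ} (hq : q ≠ 0) (z : ℚ) (P : ℚ[X]) :
    altFunctional q z P = altFunctional q (q * z)
      (divX (P.comp (C q * X) + (X - 1) * P.comp (C q⁻¹ * X))) := by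
  induction P using Polynomial.induction_on' with
  | add P R hP hR =>
    rw [map_add, hP, hR, ← map_add, ← divX_add]
    congr 2
    simp only [add_comp]
    ring
  | monomial t c =>
    rw [← C_mul_X_pow_eq_monomial]
    cases t with
    | zero =>
      have : (C c * X ^ 0).comp (C q * X) + (X - 1) * (C c * X ^ 0).comp (C q⁻¹ * X) =
        C c * X ^ 0 * X := by simp; ring
      rw [this, divX_mul_X_eq, ← smul_eq_C_mul]
      simp only [map_smul, altFunctional_X_pow, altMoment]
    | succ t =>
      have : (C c * X ^ (t + 1)).comp (C q * X) + (X - 1) * (C c * X ^ (t + 1)).comp (C q⁻¹ * X) =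
        (c • ((q ^ (t + 1))⁻¹ • X ^ (t + 1) +
          (q ^ (t + 1) - (q ^ (t + 1))⁻¹) • X ^ t)) * X := by
        simp only [smul_eq_C_mul, mul_comp, C_comp, pow_comp, X_comp, mul_pow, C_sub, ← inv_pow,
          C_pow]
        ring
      rw [this, divX_mul_X_eq, ← smul_eq_C_mul]
      simp only [map_smul, map_add, altFunctional_X_pow, smul_eq_mul]
      rw [altMoment_succ' hq t z]

lemma altFunctional_prod_sub_pow {q : ℚ} (hq : q ≠ 0) (z : ℚ) (u : ℕ) :
    altFunctional q z (∏ s ∈ range u, (X - C (q ^ s))) =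
      ∏ s ∈ range u, q ^ (s + 1) * (1 - q ^ s * z) := by
  induction u generalizing z with
  | zero => simpa [altMoment] using altFunctional_X_pow q z 0
  | succ u ih =>
    have : ∏ s ∈ range (u + 1), (X - C (q ^ s)) =
        q ^ u • ((X - 1) * (∏ s ∈ range u, (X - C (q ^ s))).comp (C q⁻¹ * X)) := by
      rw [prod_range_succ', pow_zero, C_1, mul_comm, ← mul_smul_comm,
        Polynomial.prod_comp, smul_eq_C_mul,
        C_pow, ← card_range u, ← prod_const, card_range, ← prod_mul_distrib]
      congr 1
      refine prod_congr rfl fun s _ => ?_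
      rw [sub_comp, X_comp, C_comp, mul_sub, ← mul_assoc, ← C_mul, ← C_mul, mul_inv_cancel₀ hq,
        C_1, one_mul, pow_succ']
    rw [this, map_smul, altFunctional_sub_one_mul_comp hq, ih, prod_range_succ' _ u, smul_eq_mul,
      mul_comm (q * (1 - z)), ← mul_assoc, ← card_range u, ← prod_const, card_range,
      ← prod_mul_distrib]
    congr 1
    · exact prod_congr rfl fun s _ => by ring
    · ring

lemma altFunctional_prod_sub_odd_pow {q : ℚ} (hq : q ≠ 0) (z : ℚ) (j : ℕ) :
    altFunctional q z (∏ s ∈ range j, (X - C (q ^ (2 * s + 1)))) =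
      ∏ s ∈ range j, (1 - q ^ (2 * s + 1) * z) := by
  induction j generalizing z with
  | zero => simpa [altMoment] using altFunctional_X_pow q z 0
  | succ j ih =>
    set P : ℚ[X] := ∏ s ∈ range j, (X - C (q ^ (2 * s + 1))) with hP
    have hqC : C q * C q⁻¹ = (1 : ℚ[X]) := by rw [← C_mul, mul_inv_cancel₀ hq, C_1]
    have hcomp : ∏ s ∈ range (j + 1), (X - C (q ^ (2 * s))) =
        (X - 1) * (C q ^ j * P.comp (C q⁻¹ * X)) := by
      rw [prod_range_succ', mul_zero, pow_zero, C_1, mul_comm, hP, Polynomial.prod_comp,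
        ← card_range j, ← prod_const, card_range, ← prod_mul_distrib]
      congr 1
      refine prod_congr rfl fun s _ => ?_
      simp only [sub_comp, X_comp, C_comp, C_pow, pow_comp]
      linear_combination -X * hqC
    have h1 : (∏ s ∈ range (j + 1), (X - C (q ^ (2 * s + 1)))).comp (C q * X) =
        C q ^ (j + 1) * ∏ s ∈ range (j + 1), (X - C (q ^ (2 * s))) := by
      rw [Polynomial.prod_comp, ← card_range (j + 1), ← prod_const, card_range, ← prod_mul_distrib]
      refine prod_congr rfl fun s _ => ?_
      simp only [sub_comp, X_comp, C_comp, C_pow, pow_comp]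
      ring
    have h2 : (X - 1) * (∏ s ∈ range (j + 1), (X - C (q ^ (2 * s + 1)))).comp (C q⁻¹ * X) =
        C q⁻¹ ^ (j + 1) * ((∏ s ∈ range (j + 1), (X - C (q ^ (2 * s)))) *
          (X - C (q ^ (2 * (j + 1))))) := by
      rw [← prod_range_succ, prod_range_succ' _ (j + 1), mul_zero, pow_zero, C_1, Polynomial.prod_comp,
        mul_comm _ (X - 1), ← mul_assoc, mul_comm _ (X - 1), mul_assoc,
        ← card_range (j + 1), ← prod_const, card_range, ← prod_mul_distrib]
      congr 1
      refine prod_congr rfl fun s _ => ?_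
      simp only [sub_comp, X_comp, C_comp, C_pow, pow_comp]
      linear_combination C q ^ (2 * s + 1) * hqC
    have h3 : (∏ s ∈ range (j + 1), (X - C (q ^ (2 * s + 1)))).comp (C q * X) +
        (X - 1) * (∏ s ∈ range (j + 1), (X - C (q ^ (2 * s + 1)))).comp (C q⁻¹ * X) =
        (q⁻¹ • ((X - 1) * P.comp (C q⁻¹ * X))) * X := by
      rw [h1, h2, hcomp, smul_eq_C_mul]
      have e1 : C q ^ (j + 1) * C q⁻¹ ^ (j + 1) = (1 : ℚ[X]) := by
        rw [← mul_pow, hqC, one_pow]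
      have e2 : C q⁻¹ ^ (j + 1) * C q ^ j = (C q⁻¹ : ℚ[X]) := by
        rw [pow_succ', mul_assoc, ← mul_pow, mul_comm (C q⁻¹) (C q), hqC, one_pow, mul_one]
      have e3 : (C (q ^ (2 * (j + 1))) : ℚ[X]) = C q ^ (j + 1) * C q ^ (j + 1) := by
        rw [C_pow]; ring
      rw [e3]
      linear_combination (X - 1) * P.comp (C q⁻¹ * X) * (X * e2 - C q ^ (j + 1) * C q ^ j * e1)
    rw [altFunctional_eq_divX hq, h3, divX_mul_X_eq, map_smul, altFunctional_sub_one_mul_comp hq, ih,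
      prod_range_succ', smul_eq_mul, mul_zero, zero_add, pow_one, mul_assoc, ← mul_assoc q⁻¹,
      inv_mul_cancel₀ hq, one_mul, mul_comm]
    congr 1
    exact prod_congr rfl fun s _ => by ring

/-- The moments of a family with respect to falling `q`-factorials determine its moments with
respect to falling `q²`-factorials. -/
lemma sum_prod_sub_odd_pow {A : Type*} [Fintype A] (Y : A → ℚ) {q : ℚ} (hq : q ≠ 0) (z c : ℚ)
    (M : ℕ) (hY : ∀ u ≤ M, ∑ a, ∏ s ∈ range u, (Y a - q ^ s) =
      c * ∏ s ∈ range u, q ^ (s + 1) * (1 - q ^ s * z)) {j : ℕ} (hj : j ≤ M) :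
    ∑ a, ∏ s ∈ range j, (Y a - q ^ (2 * s + 1)) =
      c * ∏ s ∈ range j, (1 - q ^ (2 * s + 1) * z) := by
  have hmono : ∀ t u, u + t ≤ M →
      ∑ a, ((∏ s ∈ range u, (X - C (q ^ s))) * X ^ t).eval (Y a) =
        c * altFunctional q z ((∏ s ∈ range u, (X - C (q ^ s))) * X ^ t) := by
    intro t
    induction t with
    | zero =>
      intro u hu
      rw [pow_zero, mul_one, altFunctional_prod_sub_pow hq, ← hY u hu]
      simp [eval_prod]
    | succ t ih =>
      intro u hu
      have : (∏ s ∈ range u, (X - C (q ^ s))) * X ^ (t + 1) =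
          (∏ s ∈ range (u + 1), (X - C (q ^ s))) * X ^ t +
            q ^ u • ((∏ s ∈ range u, (X - C (q ^ s))) * X ^ t) := by
        rw [prod_range_succ, smul_eq_C_mul]
        ring
      rw [this, map_add, map_smul, mul_add, ← ih (u + 1) (by lia), smul_eq_mul, mul_left_comm,
        ← ih u (by lia), mul_sum, ← sum_add_distrib]
      simp only [eval_add, eval_smul, smul_eq_mul]
  have hpoly : ∀ P : ℚ[X], P.natDegree ≤ M →
      ∑ a, P.eval (Y a) = c * altFunctional q z P := by
    intro P hP
    conv_rhs => rw [P.as_sum_range_C_mul_X_pow]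
    simp_rw [eval_eq_sum_range, ← smul_eq_C_mul, map_sum, map_smul, smul_eq_mul]
    rw [sum_comm, mul_sum]
    refine sum_congr rfl fun t ht => ?_
    have := hmono t 0 (by have := mem_range.1 ht; lia)
    simp only [range_zero, prod_empty, one_mul, eval_pow, eval_X] at this
    rw [← mul_sum, this]
    ring
  have hdeg : (∏ s ∈ range j, (X - C (q ^ (2 * s + 1)))).natDegree ≤ M := by
    rw [natDegree_prod_of_monic _ _ fun s _ => monic_X_sub_C _]
    simp_rw [natDegree_X_sub_C]
    simpa using hj
  have := hpoly _ hdeg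
  rw [altFunctional_prod_sub_odd_pow hq] at this
  simpa [eval_prod] using this

end MomentFunctional

/-! ### Alternating forms and character sums -/

section Forms

variable {F V : Type*} [Field F] [AddCommGroup V] [Module F V]

/-- The rank of an alternating form is even. -/
lemma LinearMap.BilinForm.IsAlt.exists_finrank_add_finrank_ker [FiniteDimensional F V]
    {B : LinearMap.BilinForm F V} (hB : B.IsAlt) :
    ∃ l, Module.finrank F V + Module.finrank F (LinearMap.ker B) = 2 * l := by
  obtain ⟨L, hL, hmax⟩ := exists_maximal_of_wellFoundedGT
    (fun L : Submodule F V => L ≤ B.orthogonal L) ⟨⊥, bot_le⟩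
  have hle : ∀ x, x ∈ B.orthogonal L → x ∈ L := by
    intro x hx
    have hiso : L ⊔ F ∙ x ≤ B.orthogonal (L ⊔ F ∙ x) := by
      intro v hv w hw
      obtain ⟨v₁, hv₁, v₂, hv₂, rfl⟩ := Submodule.mem_sup.1 hv
      obtain ⟨w₁, hw₁, w₂, hw₂, rfl⟩ := Submodule.mem_sup.1 hw
      obtain ⟨c, rfl⟩ := Submodule.mem_span_singleton.1 hv₂
      obtain ⟨d, rfl⟩ := Submodule.mem_span_singleton.1 hw₂
      have h1 : B w₁ v₁ = 0 := hL hv₁ w₁ hw₁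
      have h2 : B w₁ x = 0 := hx w₁ hw₁
      have h3 : B x v₁ = 0 := hB.isRefl _ _ (hx v₁ hv₁)
      change B (w₁ + d • x) (v₁ + c • x) = 0
      simp [h1, h2, h3, hB.self_eq_zero x]
    exact hmax hiso le_sup_left (Submodule.mem_sup_right (Submodule.mem_span_singleton_self x))
  have heq : B.orthogonal L = L := le_antisymm hle hL
  have hker : L ⊓ LinearMap.ker B = LinearMap.ker B := by
    refine inf_eq_right.2 fun x hx => hle x fun w _ => ?_
    rw [LinearMap.mem_ker] at hx
    exact hB.isRefl _ _ (by rw [hx]; rfl)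
  have := LinearMap.BilinForm.finrank_add_finrank_orthogonal' (B := B) L
  rw [heq, hker] at this
  exact ⟨_, by rw [← this, two_mul]⟩

variable [Fintype V] {ψ : AddChar F ℤ} (hψ : ψ ≠ 1)

include hψ in
lemma sum_addChar_linearMap (l : V →ₗ[F] F) :
    ∑ x, ψ (l x) = if l = 0 then (Fintype.card V : ℤ) else 0 := by
  have h := AddChar.sum_eq_ite (ψ.compAddMonoidHom l.toAddMonoidHom)
  simp only [AddChar.compAddMonoidHom_apply, LinearMap.toAddMonoidHom_coe] at h
  rw [h]
  congr 1
  refine propext ⟨fun h0 => ?_, fun h0 => ?_⟩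
  · by_contra hl
    obtain ⟨c, hc⟩ := AddChar.ne_one_iff.1 hψ
    obtain ⟨x, rfl⟩ := LinearMap.surjective hl c
    exact hc (DFunLike.congr_fun h0 x)
  · ext x
    simp [h0]

include hψ in
/-- A pairing of finite spaces has left and right kernels of the same codimension. -/
lemma card_mul_card_left_kernel {A : Type*} [AddCommGroup A] [Module F A] [Fintype A]
    (β : A →ₗ[F] V →ₗ[F] F) :
    Fintype.card V * #{a | ∀ x, β a x = 0} = Fintype.card A * #{x | ∀ a, β a x = 0} := by
  have h1 : ∑ a, ∑ x, ψ (β a x) = Fintype.card V * (#{a | ∀ x, β a x = 0} : ℤ) := by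
    simp_rw [sum_addChar_linearMap hψ, LinearMap.ext_iff, LinearMap.zero_apply]
    rw [← sum_filter, sum_const, nsmul_eq_mul, mul_comm]
  have h2 : ∑ x, ∑ a, ψ (β a x) = Fintype.card A * (#{x | ∀ a, β a x = 0} : ℤ) := by
    have : ∀ x, ∑ a, ψ (β a x) = if ∀ a, β a x = 0 then (Fintype.card A : ℤ) else 0 := by
      intro x
      have := sum_addChar_linearMap hψ (β.flip x)
      simpa only [LinearMap.ext_iff, LinearMap.zero_apply, LinearMap.flip_apply] using this
    simp_rw [this]
    rw [← sum_filter, sum_const, nsmul_eq_mul, mul_comm]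
  rw [sum_comm, h2] at h1
  exact_mod_cast h1.symm

/-- The number of linearly independent tuples in a subspace. -/
lemma card_linearIndependent_mem [Fintype F] (W : Submodule F V) (u : ℕ) :
    (#{y : Fin u → V | LinearIndependent F y ∧ ∀ s, y s ∈ W} : ℚ) =
      ∏ s ∈ range u, ((Fintype.card W : ℚ) - (Fintype.card F : ℚ) ^ s) := by
  have hcard : #{y : Fin u → V | LinearIndependent F y ∧ ∀ s, y s ∈ W} =
      Nat.card {y : Fin u → W // LinearIndependent F y} := by
    rw [Nat.card_eq_fintype_card, Fintype.card_subtype]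
    symm
    refine card_bij (fun y _ s => (y s : V)) (fun y hy => ?_) (fun y _ y' _ h => ?_)
      fun y hy => ?_
    · simp only [mem_filter, mem_univ, true_and] at hy ⊢
      exact ⟨hy.map' W.subtype W.ker_subtype, fun s => (y s).2⟩
    · funext s
      exact Subtype.ext (congrFun h s)
    · simp only [mem_filter, mem_univ, true_and] at hy
      refine ⟨fun s => ⟨y s, hy.2 s⟩, ?_, rfl⟩
      simp only [mem_filter, mem_univ, true_and]
      exact LinearIndependent.of_comp W.subtype hy.1
  have hW : Fintype.card W = Fintype.card F ^ Module.finrank F W := Module.card_eq_pow_finrank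
  rw [hcard]
  by_cases hu : u ≤ Module.finrank F W
  · rw [card_linearIndependent hu, Nat.cast_prod, prod_range, hW]
    refine prod_congr rfl fun i _ => ?_
    rw [Nat.cast_sub (Nat.pow_le_pow_right Fintype.card_pos (by lia))]
    push_cast
    rfl
  · have : IsEmpty {y : Fin u → W // LinearIndependent F y} :=
      ⟨fun y => hu (by simpa using y.2.fintype_card_le_finrank)⟩
    rw [Nat.card_of_isEmpty, Nat.cast_zero, eq_comm]
    refine prod_eq_zero (mem_range.2 (not_le.1 hu)) ?_
    rw [hW, Nat.cast_pow, sub_self]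

end Forms

section QuadraticSums

variable {F V : Type*} [Field F] [AddCommGroup V] [Module F V] [Fintype V]
  [CharP F 2] {ψ : AddChar F ℤ} (hψ : ψ ≠ 1)
  {B : LinearMap.BilinForm F V} (hB : ∀ x y, B x y = B y x)

include hψ hB in
/-- The square of the exponential sum of a quadratic form in characteristic two. -/
lemma sq_sum_addChar_quadratic {Q : V → F} (hQ : ∀ x y, Q (x + y) = Q x + Q y + B x y) :
    (∑ x, ψ (Q x)) ^ 2 = Fintype.card V * ∑ z : LinearMap.ker B, ψ (Q z) := by
  have h1 : ∀ x z, ψ (Q x) * ψ (Q (x + z)) = ψ (Q z) * ψ (B z x) := by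
    intro x z
    rw [← AddChar.map_add_eq_mul, ← AddChar.map_add_eq_mul, hQ, ← hB x z]
    congr 1
    linear_combination CharTwo.add_self_eq_zero (Q x)
  calc (∑ x, ψ (Q x)) ^ 2 = ∑ x, ∑ y, ψ (Q x) * ψ (Q y) := by rw [sq, sum_mul_sum]
    _ = ∑ x, ∑ z, ψ (Q z) * ψ (B z x) := by
      refine sum_congr rfl fun x _ => ?_
      rw [← Equiv.sum_comp (Equiv.addLeft x)]
      exact sum_congr rfl fun z _ => h1 x z
    _ = ∑ z, ψ (Q z) * if B z = 0 then (Fintype.card V : ℤ) else 0 := by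
      rw [sum_comm]
      refine sum_congr rfl fun z _ => ?_
      rw [← mul_sum, sum_addChar_linearMap hψ]
    _ = _ := by
      simp_rw [mul_ite, mul_zero]
      rw [← sum_filter, sum_subtype (p := (· ∈ LinearMap.ker B)) _ (by simp), mul_sum]
      exact sum_congr rfl fun _ _ => mul_comm _ _

include hψ hB in
lemma sq_sum_addChar_quadratic_eq_or {Q : V → F}
    (hQ : ∀ x y, Q (x + y) = Q x + Q y + B x y) :
    (∑ x, ψ (Q x)) ^ 2 = 0 ∨
      (∑ x, ψ (Q x)) ^ 2 = Fintype.card V * Fintype.card (LinearMap.ker B) := by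
  have h0 : Q 0 = 0 := by simpa using hQ 0 0
  let χ : AddChar (LinearMap.ker B) ℤ :=
    { toFun := fun z => ψ (Q z)
      map_zero_eq_one' := by simp [h0]
      map_add_eq_mul' := fun y z => by
        have hy : B y = 0 := y.2
        rw [Submodule.coe_add, hQ, hy, LinearMap.zero_apply, add_zero,
          AddChar.map_add_eq_mul] }
  have h1 : ∑ z : LinearMap.ker B, ψ (Q z) = ∑ z, χ z := rfl
  rw [sq_sum_addChar_quadratic hψ hB hQ, h1, AddChar.sum_eq_ite]
  split_ifs
  · exact Or.inr rfl
  · exact Or.inl (mul_zero _)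

end QuadraticSums

/-! ### Symmetric twisted forms -/

section Moore

variable {F K : Type*} [Field F] [Field K] [Algebra F K] [FiniteDimensional F K] (σ : K ≃ₐ[F] K)
  (hσ : ∀ x, σ x = x → x ∈ Set.range (algebraMap F K))

include hσ in
/-- The tensor `∑ t, z t ⊗ b t` vanishes as soon as enough of its twisted contractions do. -/
lemma sum_smul_eq_zero_of_twisted_sums (p : ℕ) (b z : Fin p → K)
    (h : ∀ j < p, ∑ t, b t * (σ ^ j) (z t) = 0) (f : K →ₗ[F] F) :
    ∑ t, f (z t) • b t = 0 := by
  induction p generalizing f with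
  | zero => simp
  | succ p ih =>
    by_cases hb : b 0 = 0
    · have := ih (fun t => b t.succ) (fun t => z t.succ)
        (fun j hj => by simpa [Fin.sum_univ_succ, hb] using h j (by lia)) f
      simpa [Fin.sum_univ_succ, hb] using this
    set b' : Fin (p + 1) → K := fun t => (b 0)⁻¹ * b t with hb'
    have hb0 : b' 0 = 1 := inv_mul_cancel₀ hb
    have h' : ∀ j < p + 1, ∑ t, b' t * (σ ^ j) (z t) = 0 := by
      intro j hj
      simp_rw [hb', mul_assoc]
      rw [← mul_sum, h j hj, mul_zero]
    have hfix : ∀ f : K →ₗ[F] F,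
        ∑ t, f (z t) • b' t ∈ Set.range (algebraMap F K) := by
      intro f
      apply hσ
      have := ih (fun t => σ (b' t.succ) - b' t.succ) (fun t => σ (z t.succ))
        (fun j hj => ?_) (f ∘ₗ σ.symm.toLinearMap)
      · simp only [LinearMap.comp_apply, AlgEquiv.toLinearMap_apply, AlgEquiv.symm_apply_apply,
          smul_sub, sum_sub_distrib, sub_eq_zero] at this
        rw [map_sum, Fin.sum_univ_succ, Fin.sum_univ_succ, hb0]
        simp only [map_smul, map_one]
        rw [this]
      · have h1 := congrArg σ (h' j (by lia))
        have h2 := h' (j + 1) (by lia)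
        have h3 : ∀ x, σ ((σ ^ j) x) = (σ ^ (j + 1)) x := fun x => by
          rw [pow_succ', AlgEquiv.mul_apply]
        have h4 : ∀ x, (σ ^ j) (σ x) = (σ ^ (j + 1)) x := fun x => by
          rw [pow_succ, AlgEquiv.mul_apply]
        simp only [map_sum, map_mul, h3, map_zero] at h1
        rw [Fin.sum_univ_succ, hb0] at h1 h2
        simp only [h4, sub_mul, sum_sub_distrib]
        rw [map_one] at h1
        linear_combination h1 - h2
    have hlin : ∀ f : K →ₗ[F] F, ∑ t, f (z t) • b' t = 0 := by
      let w := Module.finBasis F K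
      choose g hg using fun i => hfix (w.coord i)
      have h0 : ∑ i, g i • w i = 0 := by
        have h00 := h' 0 (by lia)
        calc ∑ i, g i • w i = ∑ i, ∑ t, b' t * (w.coord i (z t) • w i) := by
              refine sum_congr rfl fun i _ => ?_
              rw [Algebra.smul_def, hg, sum_mul]
              refine sum_congr rfl fun t _ => ?_
              rw [Algebra.smul_def, Algebra.smul_def]
              ring
          _ = ∑ t, b' t * z t := by
              rw [sum_comm]
              refine sum_congr rfl fun t _ => ?_
              rw [← mul_sum]
              congr 1
              exact w.sum_repr (z t)
          _ = 0 := by simpa using h00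
      have hg0 := Fintype.linearIndependent_iff.1 w.linearIndependent g h0
      intro f
      have hf : ∀ x, f x = ∑ i, w.coord i x * f (w i) := by
        intro x
        conv_lhs => rw [← w.sum_repr x, map_sum]
        simp only [map_smul, smul_eq_mul, Module.Basis.coord_apply]
      calc ∑ t, f (z t) • b' t = ∑ i, f (w i) • ∑ t, w.coord i (z t) • b' t := by
            simp_rw [smul_sum, smul_smul]
            rw [sum_comm]
            refine sum_congr rfl fun t _ => ?_
            rw [hf (z t), sum_smul]
            exact sum_congr rfl fun i _ => by rw [mul_comm]
        _ = 0 := by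
            refine sum_eq_zero fun i _ => ?_
            rw [← hg, hg0, map_zero, smul_zero]
    have := hlin f
    simp_rw [hb', ← smul_eq_mul, smul_comm _ (b 0)⁻¹, ← smul_sum] at this
    exact (smul_eq_zero.1 this).resolve_left (inv_ne_zero hb)

variable [CharP K 2]

include hσ in
lemma exists_symm_of_twisted_sums {u t : ℕ} (hut : u ≤ t) {y x : Fin u → K}
    (hy : LinearIndependent F y)
    (h : ∀ j < t, ∑ s, (y s * (σ ^ (j + 1)) (x s) + x s * (σ ^ (j + 1)) (y s)) = 0) :
    ∃ d : Sym2 (Fin u) → F, ∀ s, x s = ∑ v, d s(s, v) • y v := by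
  have hl : ∀ l ≤ t, ∑ s, (y s * (σ ^ l) (x s) + x s * (σ ^ l) (y s)) = 0 := by
    rintro (_ | l) hlt
    · refine sum_eq_zero fun s _ => ?_
      rw [pow_zero, AlgEquiv.one_apply, AlgEquiv.one_apply, mul_comm, CharTwo.add_self_eq_zero]
    · exact h l hlt
  have hE : ∀ j < u + u,
      ∑ s, ((σ ^ t) (x s) * (σ ^ j) (y s) + (σ ^ t) (y s) * (σ ^ j) (x s)) = 0 := by
    intro j hj
    rcases le_total j t with hjt | hjt
    · obtain ⟨l, rfl⟩ := Nat.exists_eq_add_of_le hjt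
      have := congrArg (σ ^ j) (hl l (by lia))
      rw [map_sum, map_zero] at this
      rw [← this]
      refine sum_congr rfl fun s _ => ?_
      simp only [map_add, map_mul, pow_add, AlgEquiv.mul_apply]
      ring
    · obtain ⟨l, rfl⟩ := Nat.exists_eq_add_of_le hjt
      have := congrArg (σ ^ t) (hl l (by lia))
      rw [map_sum, map_zero] at this
      rw [← this]
      refine sum_congr rfl fun s _ => ?_
      simp only [map_add, map_mul, pow_add, AlgEquiv.mul_apply]
      ring
  have hf : ∀ f : K →ₗ[F] F, ∑ s, f (y s) • x s = ∑ s, f (x s) • y s := by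
    intro f
    have := sum_smul_eq_zero_of_twisted_sums σ hσ (u + u)
      (Fin.append (fun s => (σ ^ t) (x s)) fun s => (σ ^ t) (y s)) (Fin.append y x)
      (fun j hj => by
        rw [Fin.sum_univ_add]
        simp only [Fin.append_left, Fin.append_right]
        rw [← sum_add_distrib]
        exact hE j hj) f
    rw [Fin.sum_univ_add] at this
    simp only [Fin.append_left, Fin.append_right, ← map_smul, ← map_sum] at this
    rw [← map_add] at this
    exact CharTwo.add_eq_zero.1 ((map_eq_zero_iff _ (σ ^ t).injective).1 this)
  obtain ⟨g, hg⟩ := LinearMap.exists_leftInverse_of_injective (Fintype.linearCombination F y)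
    (LinearMap.ker_eq_bot.2 hy.fintypeLinearCombination_injective)
  have hgy : ∀ v s, g (y s) v = if s = v then 1 else 0 := by
    intro v s
    have := LinearMap.congr_fun hg (Pi.single s 1)
    simp only [LinearMap.comp_apply, Fintype.linearCombination_apply_single, one_smul,
      LinearMap.id_apply] at this
    rw [this, Pi.single_apply]
    simp only [eq_comm]
  have hx : ∀ v, x v = ∑ s, g (x s) v • y s := by
    intro v
    have := hf (LinearMap.proj v ∘ₗ g)
    simpa [hgy] using this
  have hsymm : ∀ v w, g (x v) w = g (x w) v := by
    intro v w
    have := congrArg (fun z => g z w) (hx v)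
    simpa [hgy] using this
  exact ⟨Sym2.lift ⟨fun v s => g (x s) v, fun v s => hsymm s v⟩, fun v => by simpa using hx v⟩

include hσ in
lemma card_twisted_sums_eq_zero [Fintype F] [Fintype K] {u t : ℕ} (hut : u ≤ t) {y : Fin u → K}
    (hy : LinearIndependent F y) :
    #{x : Fin u → K | ∀ j < t,
      ∑ s, (y s * (σ ^ (j + 1)) (x s) + x s * (σ ^ (j + 1)) (y s)) = 0} =
      Fintype.card F ^ (u + 1).choose 2 := by
  have hcard : Fintype.card F ^ (u + 1).choose 2 = #(univ : Finset (Sym2 (Fin u) → F)) := by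
    rw [card_univ, Fintype.card_fun, Sym2.card, Fintype.card_fin]
  rw [hcard]
  symm
  refine card_bij (fun d _ s => ∑ v, d s(s, v) • y v) (fun d _ => ?_) (fun d _ d' _ hd => ?_)
    fun x hx => ?_
  · simp only [mem_filter, mem_univ, true_and]
    intro j _
    simp only [map_sum, map_smul, sum_add_distrib, mul_sum, sum_mul]
    rw [CharTwo.add_eq_zero, sum_comm]
    refine sum_congr rfl fun s _ => sum_congr rfl fun v _ => ?_
    rw [Sym2.eq_swap, mul_smul_comm, smul_mul_assoc]
  · funext a
    induction a with
    | h s v =>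
      have := congrFun hd s
      rw [← sub_eq_zero, ← sum_sub_distrib] at this
      simp_rw [← sub_smul] at this
      exact sub_eq_zero.1 (Fintype.linearIndependent_iff.1 hy _ this v)
  · simp only [mem_filter, mem_univ, true_and] at hx
    obtain ⟨d, hd⟩ := exists_symm_of_twisted_sums σ hσ hut hy hx
    exact ⟨d, mem_univ _, funext fun s => (hd s).symm⟩

end Moore

/-! ### Forms of Gold type -/

section GoldForm

variable {F K : Type*} [Field F] [Field K] [Algebra F K] (σ : K ≃ₐ[F] K) {t : ℕ}

/-- The bilinear form `(x, y) ↦ Tr (∑ j, a j * (x * σ^(j+1) y + y * σ^(j+1) x))`. -/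
noncomputable def goldForm (a : Fin t → K) : LinearMap.BilinForm F K :=
  LinearMap.mk₂ F (fun x y => Algebra.trace F K
      (∑ j : Fin t, a j * (x * (σ ^ (j + 1 : ℕ)) y + y * (σ ^ (j + 1 : ℕ)) x)))
    (fun x x' y => by
      rw [← map_add, ← sum_add_distrib]
      refine congrArg _ (sum_congr rfl fun j _ => ?_)
      rw [map_add]
      ring)
    (fun c x y => by
      rw [← map_smul, smul_sum]
      refine congrArg _ (sum_congr rfl fun j _ => ?_)
      rw [map_smul]
      simp only [Algebra.smul_def]
      ring)
    (fun x y y' => by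
      rw [← map_add, ← sum_add_distrib]
      refine congrArg _ (sum_congr rfl fun j _ => ?_)
      rw [map_add]
      ring)
    (fun c x y => by
      rw [← map_smul, smul_sum]
      refine congrArg _ (sum_congr rfl fun j _ => ?_)
      rw [map_smul]
      simp only [Algebra.smul_def]
      ring)

lemma goldForm_apply (a : Fin t → K) (x y : K) : goldForm σ a x y = Algebra.trace F K
    (∑ j : Fin t, a j * (x * (σ ^ (j + 1 : ℕ)) y + y * (σ ^ (j + 1 : ℕ)) x)) := rfl

lemma goldForm_comm (a : Fin t → K) (x y : K) : goldForm σ a x y = goldForm σ a y x := by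
  simp only [goldForm_apply, add_comm]

lemma goldForm_isAlt [CharP K 2] (a : Fin t → K) : (goldForm σ a).IsAlt := fun x => by
  simp [goldForm_apply, CharTwo.add_self_eq_zero]

lemma goldForm_zero : goldForm σ (0 : Fin t → K) = 0 := by
  ext x y
  simp [goldForm_apply]

/-- The pairing between coefficients `a` and tuples `x` given by `∑ s, goldForm σ a (y s) (x s)`. -/
noncomputable def goldPairing {u : ℕ} (y : Fin u → K) :
    (Fin t → K) →ₗ[F] (Fin u → K) →ₗ[F] F :=
  LinearMap.mk₂ F (fun a x => ∑ s, goldForm σ a (y s) (x s))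
    (fun a a' x => by
      rw [← sum_add_distrib]
      refine sum_congr rfl fun s _ => ?_
      simp only [goldForm_apply]
      rw [← map_add, ← sum_add_distrib]
      exact congrArg _ (sum_congr rfl fun j _ => add_mul _ _ _))
    (fun c a x => by
      rw [smul_sum]
      refine sum_congr rfl fun s _ => ?_
      simp only [goldForm_apply]
      rw [← map_smul, smul_sum]
      exact congrArg _ (sum_congr rfl fun j _ => smul_mul_assoc _ _ _))
    (fun a x x' => by simp [sum_add_distrib])
    (fun c a x => by simp [mul_sum])

lemma goldPairing_apply {u : ℕ} (y x : Fin u → K) (a : Fin t → K) :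
    goldPairing σ y a x = ∑ s, goldForm σ a (y s) (x s) := rfl

lemma eq_zero_of_trace_mul [Finite F] [Finite K] {x : K}
    (h : ∀ a, Algebra.trace F K (a * x) = 0) : x = 0 := by
  by_contra hx
  obtain ⟨c, hc⟩ := Algebra.trace_surjective F K 1
  have := h (c * x⁻¹)
  rw [inv_mul_cancel_right₀ hx, hc] at this
  exact one_ne_zero this

lemma goldPairing_right_eq_zero [Finite F] [Finite K] {u : ℕ} (y x : Fin u → K) :
    (∀ a : Fin t → K, goldPairing σ y a x = 0) ↔ ∀ j < t,
      ∑ s, (y s * (σ ^ (j + 1)) (x s) + x s * (σ ^ (j + 1)) (y s)) = 0 := by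
  have h : ∀ a : Fin t → K, goldPairing σ y a x = Algebra.trace F K (∑ j : Fin t,
      a j * ∑ s, (y s * (σ ^ (j + 1 : ℕ)) (x s) + x s * (σ ^ (j + 1 : ℕ)) (y s))) := by
    intro a
    simp only [goldPairing_apply, goldForm_apply, mul_sum]
    rw [← map_sum, sum_comm]
  constructor
  · intro h0 j hj
    refine eq_zero_of_trace_mul (F := F) fun c => ?_
    rw [← h0 (Pi.single (⟨j, hj⟩ : Fin t) c), h, Fintype.sum_eq_single (⟨j, hj⟩ : Fin t),
      Pi.single_eq_same]
    intro j' hj'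
    rw [Pi.single_eq_of_ne hj', zero_mul]
  · intro h0 a
    rw [h, sum_eq_zero fun j _ => by rw [h0 j j.2, mul_zero], map_zero]

lemma goldPairing_left_eq_zero {u : ℕ} (y : Fin u → K) (a : Fin t → K) :
    (∀ x, goldPairing σ y a x = 0) ↔ ∀ s, y s ∈ LinearMap.ker (goldForm σ a) := by
  simp only [LinearMap.mem_ker, goldPairing_apply]
  constructor
  · intro h s
    ext x
    have := h (Pi.single s x)
    rwa [Fintype.sum_eq_single s, Pi.single_eq_same] at this
    intro s' hs'
    rw [Pi.single_eq_of_ne hs', map_zero]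
  · intro h x
    exact sum_eq_zero fun s _ => by rw [h s]; rfl

variable [Fintype F] [Fintype K] [CharP K 2]
  (hσ : ∀ x, σ x = x → x ∈ Set.range (algebraMap F K))
  {ψ : AddChar F ℤ} (hψ : ψ ≠ 1)

include hσ hψ in
lemma card_mem_ker_goldForm {u : ℕ} (hut : u ≤ t) {y : Fin u → K}
    (hy : LinearIndependent F y) :
    Fintype.card K ^ u * #{a : Fin t → K | ∀ s, y s ∈ LinearMap.ker (goldForm σ a)} =
      Fintype.card K ^ t * Fintype.card F ^ (u + 1).choose 2 := by
  have := card_mul_card_left_kernel hψ (goldPairing σ y (t := t))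
  simpa only [goldPairing_left_eq_zero, goldPairing_right_eq_zero,
    card_twisted_sums_eq_zero σ hσ hut hy, Fintype.card_fun, Fintype.card_fin] using this

include hσ hψ in
lemma sum_prod_card_ker_goldForm {u : ℕ} (hut : u ≤ t) :
    ∑ a : Fin t → K, ∏ s ∈ range u,
      ((Fintype.card (LinearMap.ker (goldForm σ a)) : ℚ) - (Fintype.card F : ℚ) ^ s) =
    (Fintype.card K : ℚ) ^ t * ∏ s ∈ range u, (Fintype.card F : ℚ) ^ (s + 1) *
      (1 - (Fintype.card F : ℚ) ^ s * (Fintype.card K : ℚ)⁻¹) := by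
  have hK : (Fintype.card K : ℚ) ≠ 0 := by exact_mod_cast Fintype.card_ne_zero
  have hpow : ∏ s ∈ range u, (Fintype.card F : ℚ) ^ (s + 1) =
      (Fintype.card F : ℚ) ^ (u + 1).choose 2 := by
    rw [prod_pow_eq_pow_sum]
    clear hut
    induction u with
    | zero => rfl
    | succ u ih => rw [sum_range_succ, pow_add, ih, ← pow_add, Nat.choose_succ_succ' (u + 1),
        Nat.choose_one_right, add_comm]
  have htop := card_linearIndependent_mem (⊤ : Submodule F K) u
  have htc : Fintype.card (⊤ : Submodule F K) = Fintype.card K :=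
    Fintype.card_congr Submodule.topEquiv.toEquiv
  rw [htc] at htop
  simp only [Submodule.mem_top, implies_true, and_true] at htop
  calc _ = ∑ a : Fin t → K, ∑ y : Fin u → K,
        if LinearIndependent F y ∧ ∀ s, y s ∈ LinearMap.ker (goldForm σ a) then (1 : ℚ) else 0 := by
        refine sum_congr rfl fun a _ => ?_
        rw [← card_linearIndependent_mem, sum_boole]
    _ = ∑ y : Fin u → K, if LinearIndependent F y then
        (#{a : Fin t → K | ∀ s, y s ∈ LinearMap.ker (goldForm σ a)} : ℚ) else 0 := by
        rw [sum_comm]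
        refine sum_congr rfl fun y _ => ?_
        rw [← sum_boole]
        split_ifs with h <;> simp [h]
    _ = ∑ y : Fin u → K, if LinearIndependent F y then
        (Fintype.card K : ℚ) ^ t * (Fintype.card F : ℚ) ^ (u + 1).choose 2 /
          (Fintype.card K : ℚ) ^ u else 0 := by
        refine sum_congr rfl fun y _ => ?_
        split_ifs with h
        · rw [eq_div_iff (pow_ne_zero _ hK), mul_comm]
          exact_mod_cast card_mem_ker_goldForm σ hσ hψ hut h
        · rfl
    _ = _ := by
        rw [← sum_filter, sum_const, nsmul_eq_mul, htop, prod_mul_distrib, hpow]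
        have : ∀ s, 1 - (Fintype.card F : ℚ) ^ s * (Fintype.card K : ℚ)⁻¹ =
            ((Fintype.card K : ℚ) - (Fintype.card F : ℚ) ^ s) / Fintype.card K := by
          intro s
          field_simp
        simp_rw [this]
        rw [prod_div_distrib, prod_const, card_range]
        ring

end GoldForm

/-! ### The rank distribution -/

section RankDistribution

variable {F K : Type*} [Field F] [Field K] [Algebra F K] (σ : K ≃ₐ[F] K) {t : ℕ}

/-- The number `i` such that the radical of `goldForm σ a` has dimension `2 * i + 1` (in odd
dimension). -/
noncomputable def goldIndex (a : Fin t → K) : ℕ :=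
  Module.finrank F (LinearMap.ker (goldForm σ a)) / 2

variable [FiniteDimensional F K] [CharP K 2]
  {h : ℕ} (hK : Module.finrank F K = 2 * h + 1)

include hK in
lemma finrank_ker_goldForm (a : Fin t → K) :
    Module.finrank F (LinearMap.ker (goldForm σ a)) = 2 * goldIndex σ a + 1 := by
  obtain ⟨l, hl⟩ := (goldForm_isAlt σ a).exists_finrank_add_finrank_ker
  rw [goldIndex]
  lia

include hK in
lemma card_ker_goldForm [Fintype F] [Fintype K] (a : Fin t → K) :
    Fintype.card (LinearMap.ker (goldForm σ a)) = Fintype.card F ^ (2 * goldIndex σ a + 1) := by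
  rw [Module.card_eq_pow_finrank (K := F), finrank_ker_goldForm σ hK]

include hK in
lemma goldIndex_zero : goldIndex σ (0 : Fin t → K) = h := by
  have := finrank_ker_goldForm σ hK (0 : Fin t → K)
  rw [goldForm_zero, LinearMap.ker_zero, finrank_top, hK] at this
  lia

variable [Fintype F] [Fintype K] (hσ : ∀ x, σ x = x → x ∈ Set.range (algebraMap F K))
  {ψ : AddChar F ℤ} (hψ : ψ ≠ 1)

include hK hσ hψ in
lemma sum_gaussBinom_goldIndex {j : ℕ} (hj : j ≤ t) :
    ∑ a : Fin t → K, gaussBinom ((Fintype.card F : ℚ) ^ 2) (goldIndex σ a) j =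
      gaussBinom ((Fintype.card F : ℚ) ^ 2) h j * (Fintype.card K : ℚ) ^ (t - j) := by
  set q := (Fintype.card F : ℚ) with hq
  have hq1 : 1 < q := Nat.one_lt_cast.2 (Fintype.one_lt_card (α := F))
  have hq0 : q ≠ 0 := by positivity
  have hc : (Fintype.card K : ℚ) = q ^ (2 * h + 1) := by
    rw [Module.card_eq_pow_finrank (K := F), hK, Nat.cast_pow]
  set c := (Fintype.card K : ℚ)
  have hc0 : c ≠ 0 := by rw [hc]; positivity
  have key := sum_prod_sub_odd_pow
    (fun a : Fin t → K => (Fintype.card (LinearMap.ker (goldForm σ a)) : ℚ)) hq0 c⁻¹ (c ^ t) t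
    (fun u hu => sum_prod_card_ker_goldForm σ hσ hψ hu) hj
  have h1 : ∀ a : Fin t → K, ∏ s ∈ range j,
      ((Fintype.card (LinearMap.ker (goldForm σ a)) : ℚ) - q ^ (2 * s + 1)) =
      q ^ j * (gaussBinom (q ^ 2) (goldIndex σ a) j *
        ∏ s ∈ range j, ((q ^ 2) ^ j - (q ^ 2) ^ s)) := by
    intro a
    rw [gaussBinom_mul_prod]
    nth_rw 2 [← card_range j]
    rw [← prod_const, ← prod_mul_distrib]
    refine prod_congr rfl fun s _ => ?_
    rw [card_ker_goldForm σ hK, Nat.cast_pow, ← hq]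
    ring
  have h2 : ∏ s ∈ range j, (1 - q ^ (2 * s + 1) * c⁻¹) =
      (q / c) ^ j * (gaussBinom (q ^ 2) h j * ∏ s ∈ range j, ((q ^ 2) ^ j - (q ^ 2) ^ s)) := by
    rw [gaussBinom_mul_prod]
    nth_rw 2 [← card_range j]
    rw [← prod_const, ← prod_mul_distrib]
    refine prod_congr rfl fun s _ => ?_
    rw [div_mul_eq_mul_div, eq_div_iff hc0, sub_mul, inv_mul_cancel_right₀ hc0, hc]
    ring
  simp_rw [h1, h2] at key
  rw [← mul_sum, ← sum_mul] at key
  have hP := prod_pow_sub_pow_ne_zero (b := q ^ 2) (by nlinarith) (le_refl j)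
  refine mul_right_cancel₀ hP (mul_left_cancel₀ (pow_ne_zero j hq0) (key.trans ?_))
  rw [div_pow, ← Nat.sub_add_cancel hj, pow_add, Nat.add_sub_cancel]
  field_simp

include hK hσ hψ in
lemma goldIndex_lt {a : Fin t → K} (ha : a ≠ 0) : goldIndex σ a < t := by
  have hq1 : (1 : ℚ) < (Fintype.card F : ℚ) ^ 2 :=
    one_lt_pow₀ (by exact_mod_cast Fintype.one_lt_card) two_ne_zero
  have key := sum_gaussBinom_goldIndex σ hK hσ hψ (le_refl t)
  rw [Nat.sub_self, pow_zero, mul_one, ← add_sum_erase _ _ (mem_univ 0), goldIndex_zero σ hK,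
    add_eq_left] at key
  have hnn : ∀ l, 0 ≤ gaussBinom ((Fintype.card F : ℚ) ^ 2) l t := fun l => by
    rcases lt_or_ge l t with hl | hl
    · rw [gaussBinom_eq_zero_of_lt _ hl]
    · exact (gaussBinom_pos hq1 hl).le
  by_contra hlt
  have := (sum_eq_zero_iff_of_nonneg fun a _ => hnn _).1 key a (mem_erase.2 ⟨ha, mem_univ a⟩)
  exact (gaussBinom_pos hq1 (not_lt.1 hlt)).ne' this

include hK hσ hψ in
/-- The number of forms of Gold type with a radical of given dimension. -/
lemma card_goldIndex_eq (hth : t ≤ h) {i : ℕ} (hi : i < t) :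
    (#{a : Fin t → K | goldIndex σ a = i} : ℚ) = ∑ j ∈ Icc i (t - 1),
      (-1) ^ (j - i) * ((Fintype.card F : ℚ) ^ 2) ^ ((j - i).choose 2) *
        gaussBinom ((Fintype.card F : ℚ) ^ 2) j i * gaussBinom ((Fintype.card F : ℚ) ^ 2) h j *
        ((Fintype.card K : ℚ) ^ (t - j) - 1) := by
  have hq1 : (1 : ℚ) < (Fintype.card F : ℚ) ^ 2 :=
    one_lt_pow₀ (by exact_mod_cast Fintype.one_lt_card) two_ne_zero
  set b := (Fintype.card F : ℚ) ^ 2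
  have hne : ∀ j ≤ t, ∑ a ∈ univ.erase (0 : Fin t → K), gaussBinom b (goldIndex σ a) j =
      gaussBinom b h j * ((Fintype.card K : ℚ) ^ (t - j) - 1) := by
    intro j hj
    have key := sum_gaussBinom_goldIndex σ hK hσ hψ hj
    rw [← add_sum_erase _ _ (mem_univ 0), goldIndex_zero σ hK] at key
    linear_combination key
  calc (#{a : Fin t → K | goldIndex σ a = i} : ℚ)
      = ∑ a ∈ univ.erase (0 : Fin t → K), if goldIndex σ a = i then (1 : ℚ) else 0 := by
        rw [← sum_boole, ← add_sum_erase _ _ (mem_univ 0), goldIndex_zero σ hK,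
          if_neg (by lia), zero_add]
    _ = ∑ a ∈ univ.erase (0 : Fin t → K), ∑ j ∈ Icc i (t - 1), (-1) ^ (j - i) *
          b ^ ((j - i).choose 2) * gaussBinom b j i * gaussBinom b (goldIndex σ a) j := by
        refine sum_congr rfl fun a ha => ?_
        have := goldIndex_lt σ hK hσ hψ (mem_erase.1 ha).1
        rw [sum_gaussBinom_orthogonality hq1 (by lia)]
    _ = _ := by
        rw [sum_comm]
        refine sum_congr rfl fun j hj => ?_
        rw [← mul_sum, hne j (by have := mem_Icc.1 hj; lia), mul_assoc _ (gaussBinom b h j)]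

end RankDistribution

/-! ### Exponential sums -/

section ExponentialSums

variable {F K : Type*} [Field F] [Field K] [Algebra F K] (σ : K ≃ₐ[F] K) {t : ℕ}

/-- The quadratic form `x ↦ Tr (c * x) + Tr (∑ j, a j * (x * σ^(j+1) x))`. -/
noncomputable def goldQuad (c : K) (a : Fin t → K) (x : K) : F :=
  Algebra.trace F K (c * x) +
    Algebra.trace F K (∑ j : Fin t, a j * (x * (σ ^ (j + 1 : ℕ)) x))

lemma goldQuad_zero_right (c : K) (a : Fin t → K) : goldQuad σ c a 0 = 0 := by
  simp [goldQuad]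

lemma goldQuad_add (c : K) (a : Fin t → K) (x y : K) :
    goldQuad σ c a (x + y) = goldQuad σ c a x + goldQuad σ c a y + goldForm σ a x y := by
  have h : ∑ j : Fin t, a j * ((x + y) * (σ ^ (j + 1 : ℕ)) (x + y)) =
      ∑ j : Fin t, a j * (x * (σ ^ (j + 1 : ℕ)) x) + ∑ j : Fin t, a j * (y * (σ ^ (j + 1 : ℕ)) y) +
      ∑ j : Fin t, a j * (x * (σ ^ (j + 1 : ℕ)) y + y * (σ ^ (j + 1 : ℕ)) x) := by
    rw [← sum_add_distrib, ← sum_add_distrib]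
    refine sum_congr rfl fun j _ => ?_
    rw [map_add]
    ring
  simp only [goldQuad, goldForm_apply]
  rw [h, mul_add, map_add, map_add, map_add]
  ring

lemma goldQuad_sub (c c' : K) (a a' : Fin t → K) (x : K) :
    goldQuad σ (c - c') (a - a') x = goldQuad σ c a x - goldQuad σ c' a' x := by
  simp only [goldQuad, Pi.sub_apply, sub_mul, sum_sub_distrib, map_sub]
  ring

variable [Fintype F] [Fintype K] {ψ : AddChar F ℤ} (hψ : ψ ≠ 1)

include hψ in
lemma sum_addChar_trace_mul (x : K) :
    ∑ c, ψ (Algebra.trace F K (c * x)) = if x = 0 then (Fintype.card K : ℤ) else 0 := by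
  have := sum_addChar_linearMap hψ (Algebra.trace F K ∘ₗ LinearMap.mulRight F x)
  simp only [LinearMap.comp_apply, LinearMap.mulRight_apply] at this
  rw [this]
  congr 1
  refine propext ⟨fun h => eq_zero_of_trace_mul fun a => LinearMap.congr_fun h a, ?_⟩
  rintro rfl
  ext
  simp

variable [CharP K 2] {h : ℕ} (hK : Module.finrank F K = 2 * h + 1)

include hψ hK in
lemma sq_sum_goldQuad_eq_or (c : K) (a : Fin t → K) :
    (∑ x, ψ (goldQuad σ c a x)) ^ 2 = 0 ∨
      (∑ x, ψ (goldQuad σ c a x)) ^ 2 = ((Fintype.card F : ℤ) ^ (h + goldIndex σ a + 1)) ^ 2 := by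
  have : CharP F 2 := (Algebra.charP_iff F K 2).2 inferInstance
  convert sq_sum_addChar_quadratic_eq_or hψ (goldForm_comm σ a) (goldQuad_add σ c a) using 2
  rw [card_ker_goldForm σ hK, Module.card_eq_pow_finrank (K := F) (V := K), hK]
  push_cast
  ring

include hψ hK in
/-- The distribution of the values of the exponential sum when the quadratic part is fixed. -/
lemma card_sum_goldQuad_eq (a : Fin t → K) {ε : ℤ} (hε : ε = 1 ∨ ε = -1) :
    2 * ((Fintype.card F : ℤ) ^ (h + goldIndex σ a + 1)) ^ 2 *
      #{c | ∑ x, ψ (goldQuad σ c a x) = ε * (Fintype.card F : ℤ) ^ (h + goldIndex σ a + 1)} =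
    (Fintype.card K : ℤ) ^ 2 +
      ε * (Fintype.card F : ℤ) ^ (h + goldIndex σ a + 1) * Fintype.card K := by
  have : CharP F 2 := (Algebra.charP_iff F K 2).2 inferInstance
  have hsum : ∑ c, ∑ x, ψ (goldQuad σ c a x) = Fintype.card K := by
    rw [sum_comm, Fintype.sum_eq_single 0]
    · simp [goldQuad_zero_right]
    · intro x hx
      simp only [goldQuad, AddChar.map_add_eq_mul]
      rw [← sum_mul, sum_addChar_trace_mul hψ, if_neg hx, zero_mul]
  have hsq : ∑ c, (∑ x, ψ (goldQuad σ c a x)) ^ 2 = (Fintype.card K : ℤ) ^ 2 := by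
    simp_rw [fun c => sq_sum_addChar_quadratic hψ (goldForm_comm σ a) (goldQuad_add σ c a)]
    rw [← mul_sum, sum_comm, Fintype.sum_eq_single 0]
    · simp [goldQuad_zero_right, sq]
    · intro x hx
      simp only [goldQuad, AddChar.map_add_eq_mul]
      rw [← sum_mul, sum_addChar_trace_mul hψ, if_neg (by simpa using hx), zero_mul]
  have hor := fun c => sq_sum_goldQuad_eq_or σ hψ hK c a
  set w := (Fintype.card F : ℤ) ^ (h + goldIndex σ a + 1)
  have hw : 0 < w := pow_pos (Nat.cast_pos.2 Fintype.card_pos) _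
  have hpt : ∀ c, 2 * w ^ 2 * (if ∑ x, ψ (goldQuad σ c a x) = ε * w then 1 else 0) =
      (∑ x, ψ (goldQuad σ c a x)) ^ 2 + ε * w * ∑ x, ψ (goldQuad σ c a x) := by
    intro c
    have hε2 : ε ^ 2 = 1 := by rcases hε with rfl | rfl <;> norm_num
    split_ifs with hc
    · rw [hc]
      linear_combination (-2 * w ^ 2) * hε2
    · rcases hor c with h0 | h0
      · rw [h0, pow_eq_zero_iff two_ne_zero |>.1 h0]
        ring
      · have h1 : (∑ x, ψ (goldQuad σ c a x) - ε * w) *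
            (∑ x, ψ (goldQuad σ c a x) + ε * w) = 0 := by
          linear_combination h0 - w ^ 2 * hε2
        have h2 := (mul_eq_zero.1 h1).resolve_left (sub_ne_zero.2 hc)
        linear_combination (-∑ x, ψ (goldQuad σ c a x)) * h2
  rw [← hsq, ← hsum, mul_sum, ← sum_add_distrib, ← sum_boole, mul_sum]
  exact sum_congr rfl fun c _ => hpt c

include hψ hK in
lemma card_sum_goldQuad_pair_eq (hth : t ≤ h) {i : ℕ} (hi : i < t) {ε : ℤ}
    (hε : ε = 1 ∨ ε = -1) :
    (#{p : K × (Fin t → K) |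
        ∑ x, ψ (goldQuad σ p.1 p.2 x) = ε * (Fintype.card F : ℤ) ^ (h + i + 1)} : ℚ) =
      1 / 2 * ((Fintype.card F : ℚ) ^ (2 * (h - i)) + ε * (Fintype.card F : ℚ) ^ (h - i)) *
      #{a : Fin t → K | goldIndex σ a = i} := by
  have hq1 : 1 < (Fintype.card F : ℤ) := Nat.one_lt_cast.2 Fintype.one_lt_card
  have hfib : ∀ a : Fin t → K, (#{c | ∑ x, ψ (goldQuad σ c a x) =
      ε * (Fintype.card F : ℤ) ^ (h + i + 1)} : ℚ) = if goldIndex σ a = i then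
      1 / 2 * ((Fintype.card F : ℚ) ^ (2 * (h - i)) + ε * (Fintype.card F : ℚ) ^ (h - i))
      else 0 := by
    intro a
    split_ifs with hai
    · have key := card_sum_goldQuad_eq σ hψ hK a hε
      rw [hai, Module.card_eq_pow_finrank (K := F) (V := K), hK] at key
      obtain ⟨n, rfl⟩ := Nat.exists_eq_add_of_le (hi.le.trans hth)
      rw [Nat.add_sub_cancel_left]
      have hq0 : (Fintype.card F : ℚ) ≠ 0 := Nat.cast_ne_zero.2 Fintype.card_ne_zero
      have key' := congrArg (Int.cast : ℤ → ℚ) key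
      push_cast at key'
      refine mul_left_cancel₀ (mul_ne_zero two_ne_zero (pow_ne_zero 2
        (pow_ne_zero (i + n + i + 1) hq0))) (key'.trans ?_)
      ring
    · rw [Nat.cast_eq_zero, card_eq_zero, filter_eq_empty_iff]
      intro c _ hc
      have hε2 : ε ^ 2 = 1 := by rcases hε with rfl | rfl <;> norm_num
      have hor := sq_sum_goldQuad_eq_or σ hψ hK c a
      rw [hc, mul_pow, hε2, one_mul] at hor
      rcases hor with h0 | h0
      · exact (pow_pos (pow_pos (zero_lt_one.trans hq1) _) 2).ne' h0
      · rw [← pow_mul, ← pow_mul] at h0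
        have := pow_right_injective₀ (zero_lt_one.trans hq1) hq1.ne' h0
        lia
  have hfub : (#{p : K × (Fin t → K) |
        ∑ x, ψ (goldQuad σ p.1 p.2 x) = ε * (Fintype.card F : ℤ) ^ (h + i + 1)} : ℚ) =
      ∑ a : Fin t → K, (#{c | ∑ x, ψ (goldQuad σ c a x) =
        ε * (Fintype.card F : ℤ) ^ (h + i + 1)} : ℚ) := by
    simp_rw [← sum_boole]
    rw [Fintype.sum_prod_type_right]
  rw [hfub]
  simp_rw [hfib]
  rw [← sum_filter, sum_const, nsmul_eq_mul, mul_comm]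

variable (hσ : ∀ x, σ x = x → x ∈ Set.range (algebraMap F K))

include hψ hK hσ in
lemma eq_zero_of_goldQuad (hth : t ≤ h) {c : K} {a : Fin t → K}
    (h1 : ∑ x, ψ (goldQuad σ c a x) = Fintype.card K) : c = 0 ∧ a = 0 := by
  have hq1 : 1 < (Fintype.card F : ℤ) := Nat.one_lt_cast.2 Fintype.one_lt_card
  have ha : a = 0 := by
    by_contra ha
    have hlt := goldIndex_lt σ hK hσ hψ ha
    have hor := sq_sum_goldQuad_eq_or σ hψ hK c a
    rw [h1, Module.card_eq_pow_finrank (K := F) (V := K), hK, Nat.cast_pow] at hor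
    rcases hor with h0 | h0
    · exact (pow_pos (pow_pos (zero_lt_one.trans hq1) _) 2).ne' h0
    · rw [← pow_mul, ← pow_mul] at h0
      have := pow_right_injective₀ (zero_lt_one.trans hq1) hq1.ne' h0
      lia
  subst ha
  refine ⟨?_, rfl⟩
  by_contra hc
  have := sum_addChar_trace_mul hψ c
  rw [if_neg hc] at this
  simp only [goldQuad, Pi.zero_apply, zero_mul, sum_const_zero, map_zero, add_zero,
    mul_comm c, this] at h1
  exact Fintype.card_ne_zero (Nat.cast_eq_zero.1 h1.symm)

end ExponentialSums

/-! ### Finite fields of characteristic two -/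

section FiniteField

/-- The canonical character of a finite field of characteristic two. -/
noncomputable def signTraceChar (F : Type*) [Field F] [Algebra (ZMod 2) F] : AddChar F ℤ where
  toFun c := (-1) ^ (Algebra.trace (ZMod 2) F c).val
  map_zero_eq_one' := by simp
  map_add_eq_mul' a b := by
    have h : ∀ x y : ZMod 2, (-1 : ℤ) ^ (x + y).val = (-1) ^ x.val * (-1) ^ y.val := by decide
    rw [map_add, h]

lemma signTraceChar_apply {F : Type*} [Field F] [Algebra (ZMod 2) F] (c : F) :
    signTraceChar F c = (-1) ^ (Algebra.trace (ZMod 2) F c).val := rfl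

variable {F K : Type*} [Field F] [Field K] [Algebra F K] [Fintype F] [Fintype K]

lemma mem_range_algebraMap_of_pow_card {x : K} (hx : x ^ Fintype.card F = x) :
    x ∈ Set.range (algebraMap F K) := by
  rw [IsGalois.mem_range_algebraMap_iff_fixed]
  intro f
  obtain ⟨n, rfl⟩ := (FiniteField.bijective_frobeniusAlgEquivOfAlgebraic_pow F K).2 f
  change (FiniteField.frobeniusAlgEquivOfAlgebraic F K ^ (n : ℕ)) x = x
  rw [AlgEquiv.coe_pow]
  exact Function.iterate_fixed hx _

lemma mem_range_algebraMap_of_pow_two_pow {m d e : ℕ} (he : e = Nat.gcd m d)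
    (hF : Fintype.card F = 2 ^ e) (hK : Fintype.card K = 2 ^ m) {x : K} (hx : x ^ 2 ^ d = x) :
    x ∈ Set.range (algebraMap F K) := by
  apply mem_range_algebraMap_of_pow_card
  have hper : ∀ n, Function.IsPeriodicPt (fun y : K => y ^ 2) n x ↔ x ^ 2 ^ n = x := by
    intro n
    rw [Function.IsPeriodicPt, Function.IsFixedPt, pow_iterate]
  rw [hF, he, ← hper]
  refine ((hper m).2 ?_).gcd ((hper d).2 hx)
  rw [← hK, FiniteField.pow_card]

/-- The summation over the nonzero elements of a finite field by powers of a primitive element. -/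
lemma add_sum_inv_pow_primitive {M : Type*} [AddCommMonoid M] {n : ℕ} (hn : Fintype.card K = n + 1)
    (hn0 : n ≠ 0) {π : K} (hπ : orderOf π = n) (f : K → M) :
    f 0 + ∑ i : Fin n, f (π⁻¹ ^ (i : ℕ)) = ∑ x, f x := by
  have hπ0 : π ≠ 0 := by
    rintro rfl
    exact hn0 (by simpa using hπ.symm)
  let u : Kˣ := (Units.mk0 π hπ0)⁻¹
  have hu : orderOf u = n := by
    rw [orderOf_inv, ← orderOf_units, Units.val_mk0, hπ]
  have hbij : Function.Bijective fun i : Fin n => u ^ (i : ℕ) := by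
    rw [Fintype.bijective_iff_injective_and_card]
    refine ⟨fun i j hij => Fin.ext (pow_injOn_Iio_orderOf ?_ ?_ hij), ?_⟩
    · exact hu.symm ▸ i.2
    · exact hu.symm ▸ j.2
    · rw [Fintype.card_fin, Fintype.card_units, hn, Nat.add_sub_cancel]
  have h1 : ∑ i : Fin n, f (π⁻¹ ^ (i : ℕ)) = ∑ v : Kˣ, f v := by
    rw [← hbij.sum_comp fun v : Kˣ => f v]
    exact sum_congr rfl fun i _ => by simp [u]
  rw [h1, ← add_sum_erase univ f (mem_univ 0)]
  congr 1
  refine sum_bij (fun v _ => (v : K)) (fun v _ => by simp) (fun v _ v' _ h => Units.ext h)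
    (fun x hx => ⟨Units.mk0 x (mem_erase.1 hx).1, mem_univ _, rfl⟩) fun _ _ => rfl

lemma signTraceChar_ne_one [Algebra (ZMod 2) F] : signTraceChar F ≠ 1 := by
  obtain ⟨c, hc⟩ := Algebra.trace_surjective (ZMod 2) F 1
  refine AddChar.ne_one_iff.2 ⟨c, ?_⟩
  rw [signTraceChar_apply, hc]
  decide

end FiniteField

/-- DC component distribution of the Gold type code of relative dimension `k`:
writing `r = (m-e)/e - 2i`, the number `α_{r,ε}` of nonzero codewords with
`DC(c) = -1 + ε·2^{m - er/2}` equals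
`(1/2)(2^{er} + ε·2^{er/2}) Σ_{j=i}^{k-2} (-1)^{j-i} 4^{e·C(j-i,2)}
(j choose i)_{4^e} ((m-e)/(2e) choose j)_{4^e} (2^{m(k-1-j)} - 1)`. -/
theorem gold_code_dc_distribution (m d e k : ℕ)
    (hm : 0 < m) (hd : 0 < d) (he : 0 < e)
    (he1 : e = Nat.gcd m d) (he2 : e = Nat.gcd m (2 * d))
    (hk1 : 2 ≤ k) (hk2 : k ≤ (m + e) / (2 * e))
    (F K : Type*) [Field F] [Field K] [Algebra F K] [Fintype F] [Fintype K]
    [Algebra (ZMod 2) F]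
    (hF : Fintype.card F = 2 ^ e) (hK : Fintype.card K = 2 ^ m)
    (π : K) (hπ : orderOf π = 2 ^ m - 1)
    (Q : (Fin k → K) → K → F)
    (hQ : ∀ a x, Q a x = ∑ j : Fin k,
      (if (j : ℕ) = 0 then Algebra.trace F K (a j * x)
       else Algebra.trace F K (a j * x ^ (2 ^ ((j : ℕ) * d) + 1))))
    (cw : (Fin k → K) → Fin (2 ^ m - 1) → ZMod 2)
    (hcw : ∀ a i, cw a i = Algebra.trace (ZMod 2) F (Q a (π⁻¹ ^ (i : ℕ))))
    (DC : (Fin (2 ^ m - 1) → ZMod 2) → ℤ)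
    (hDC : ∀ c, DC c = ∑ i : Fin (2 ^ m - 1), (-1 : ℤ) ^ (c i).val)
    (i : ℕ) (hi : i ≤ k - 2) (ε : ℤ) (hε : ε = 1 ∨ ε = -1)
    (r : ℕ) (hrdef : r = (m - e) / e - 2 * i) :
    (((Finset.univ.image cw).filter
        (fun c => c ≠ 0 ∧ DC c = -1 + ε * 2 ^ (m - e * (r / 2)))).card : ℚ) =
      (1 / 2 : ℚ) * ((2 : ℚ) ^ (e * r) + (ε : ℚ) * 2 ^ (e * (r / 2))) *
        ∑ j ∈ Finset.Icc i (k - 2),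
          (-1 : ℚ) ^ (j - i) * (4 : ℚ) ^ (e * Nat.choose (j - i) 2) *
            gaussBinom ((4 : ℚ) ^ e) j i *
            gaussBinom ((4 : ℚ) ^ e) ((m - e) / (2 * e)) j *
            (2 ^ (m * (k - 1 - j)) - 1) := by
  obtain ⟨t, rfl⟩ : ∃ t, k = t + 1 := ⟨k - 1, by lia⟩
  obtain ⟨n, hn⟩ : e ∣ m := he1 ▸ Nat.gcd_dvd_left m d
  obtain ⟨d', hd'⟩ : e ∣ d := he1 ▸ Nat.gcd_dvd_right m d
  have hodd : ∃ h, n = 2 * h + 1 := by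
    by_contra! hcon
    obtain ⟨l, rfl⟩ : 2 ∣ n := by
      by_contra h2
      exact hcon (n / 2) (by lia)
    have h1 : e * 2 ∣ Nat.gcd m (2 * d) :=
      Nat.dvd_gcd ⟨l, by rw [hn]; ring⟩ ⟨d', by rw [hd']; ring⟩
    rw [← he2] at h1
    have := Nat.le_of_dvd he h1
    lia
  obtain ⟨h, rfl⟩ := hodd
  have hA1 : (m + e) / (2 * e) = h + 1 :=
    Nat.div_eq_of_eq_mul_right (by positivity) (by rw [hn]; ring)
  have hA2 : (m - e) / (2 * e) = h :=
    Nat.div_eq_of_eq_mul_right (by positivity) (by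
      rw [hn, mul_add, mul_one, Nat.add_sub_cancel]
      ring)
  have hA3 : (m - e) / e = 2 * h :=
    Nat.div_eq_of_eq_mul_right he (by rw [hn, mul_add, mul_one, Nat.add_sub_cancel])
  rw [hA1] at hk2
  rw [hA3] at hrdef
  have hth : t ≤ h := by lia
  have hit : i < t := by lia
  have hr2 : r / 2 = h - i := by lia
  have hr : r = 2 * (h - i) := by lia
  have hme : m - e * (r / 2) = e * (h + i + 1) := by
    obtain ⟨n, rfl⟩ := Nat.exists_eq_add_of_le (hit.le.trans hth)
    rw [hr2, hn, Nat.add_sub_cancel_left, ← Nat.mul_sub]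
    congr 1
    lia
  have : CharP F 2 := charP_of_injective_algebraMap (algebraMap (ZMod 2) F).injective 2
  have : CharP K 2 := (Algebra.charP_iff F K 2).1 inferInstance
  have hfin : Module.finrank F K = 2 * h + 1 := by
    have hc := Module.card_eq_pow_finrank (K := F) (V := K)
    rw [hK, hF, ← pow_mul, hn] at hc
    exact (Nat.eq_of_mul_eq_mul_left he (Nat.pow_right_injective le_rfl hc)).symm
  let σ : K ≃ₐ[F] K := FiniteField.frobeniusAlgEquivOfAlgebraic F K ^ d'
  have hσpow : ∀ (j : ℕ) (x : K), (σ ^ j) x = x ^ 2 ^ (j * d) := by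
    intro j x
    rw [← pow_mul, AlgEquiv.coe_pow, FiniteField.coe_frobeniusAlgEquivOfAlgebraic_iterate, hF,
      ← pow_mul, hd']
    ring
  have hσ : ∀ x, σ x = x → x ∈ Set.range (algebraMap F K) := fun x hx =>
    mem_range_algebraMap_of_pow_two_pow he1 hF hK (by
      rw [← hx, ← one_mul d, ← hσpow, pow_one, hx, hx])
  have hψ := signTraceChar_ne_one (F := F)
  have hQ' : ∀ a x, Q a x = goldQuad σ (a 0) (Fin.tail a) x := by
    intro a x
    rw [hQ, Fin.sum_univ_succ, goldQuad, map_sum, if_pos (show ((0 : Fin (t + 1)) : ℕ) = 0 from rfl)]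
    congr 1
    refine sum_congr rfl fun j _ => ?_
    rw [if_neg (by simp), hσpow, Fin.val_succ, pow_succ', Fin.tail]
  have hcard : Fintype.card K = (2 ^ m - 1) + 1 := by
    rw [hK, Nat.sub_add_cancel Nat.one_le_two_pow]
  have hm1 : 2 ^ m - 1 ≠ 0 := Nat.sub_ne_zero_of_lt (Nat.one_lt_two_pow hm.ne')
  have hsum : ∀ a, DC (cw a) =
      -1 + ∑ x, signTraceChar F (goldQuad σ (a 0) (Fin.tail a) x) := by
    intro a
    rw [hDC, ← add_sum_inv_pow_primitive hcard hm1 hπ, goldQuad_zero_right,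
      AddChar.map_zero_eq_one, neg_add_cancel_left]
    exact sum_congr rfl fun l _ => by rw [hcw, hQ', signTraceChar_apply]
  have hinj : Function.Injective cw := by
    intro a a' haa
    have h1 : ∑ x, signTraceChar F
        (goldQuad σ (a 0 - a' 0) (Fin.tail a - Fin.tail a') x) = Fintype.card K := by
      rw [← add_sum_inv_pow_primitive hcard hm1 hπ, goldQuad_zero_right,
        AddChar.map_zero_eq_one, hcard, Nat.cast_add_one, add_comm]
      congr 1
      rw [sum_congr rfl (g := fun _ => 1), sum_const, card_univ, Fintype.card_fin,
        nsmul_eq_mul, mul_one]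
      intro l _
      have := congrFun haa l
      rw [hcw, hcw, hQ', hQ'] at this
      rw [signTraceChar_apply, goldQuad_sub, map_sub, this, sub_self, ZMod.val_zero, pow_zero]
    obtain ⟨h0, h2⟩ := eq_zero_of_goldQuad σ hψ hfin hσ hth h1
    rw [← Fin.cons_self_tail a, ← Fin.cons_self_tail a', sub_eq_zero.1 h0, sub_eq_zero.1 h2]
  have hcount : #{c ∈ univ.image cw | c ≠ 0 ∧ DC c = -1 + ε * 2 ^ (m - e * (r / 2))} =
      #{p : K × (Fin t → K) | ∑ x, signTraceChar F (goldQuad σ p.1 p.2 x) =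
        ε * (Fintype.card F : ℤ) ^ (h + i + 1)} := by
    rw [filter_image, card_image_of_injective _ hinj]
    refine card_equiv (Fin.consEquiv fun _ => K).symm fun a => ?_
    simp only [mem_filter, mem_univ, true_and, hsum, add_right_inj, hme, hF, Nat.cast_pow,
      Nat.cast_ofNat, ← pow_mul]
    refine ⟨fun ha => ha.2, fun ha => ⟨fun h0 => ?_, ha⟩⟩
    have h1 : (2 : ℤ) ^ m = ε * 2 ^ (e * (h + i + 1)) := by
      have h2 := hsum a
      rw [h0, hDC] at h2
      simp only [Pi.zero_apply, ZMod.val_zero, pow_zero, sum_const, card_univ, Fintype.card_fin,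
        nsmul_eq_mul, mul_one] at h2
      rw [Nat.cast_sub Nat.one_le_two_pow, sub_eq_neg_add] at h2
      push_cast at h2
      exact (add_left_cancel h2).trans ha
    have h3 : (2 : ℤ) ^ (m * 2) = 2 ^ (e * (h + i + 1) * 2) := by
      have hε2 : ε ^ 2 = 1 := by rcases hε with rfl | rfl <;> norm_num
      rw [pow_mul, h1, mul_pow, hε2, one_mul, ← pow_mul]
    have h4 := Nat.eq_of_mul_eq_mul_right two_pos
      (pow_right_injective₀ (zero_lt_two' ℤ) (by norm_num) h3)
    rw [hn] at h4
    have := Nat.eq_of_mul_eq_mul_left he h4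
    lia
  rw [hcount, card_sum_goldQuad_pair_eq σ hψ hfin hth hit hε,
    card_goldIndex_eq σ hfin hσ hψ hth hit, hF, hK, hA2, hr2, hr]
  have hb : (((2 ^ e : ℕ) : ℚ)) ^ 2 = 4 ^ e := by
    rw [Nat.cast_pow, ← pow_mul, mul_comm, pow_mul]
    norm_num
  rw [hb, Nat.add_sub_cancel]
  push_cast
  simp only [← pow_mul]
end

section
/- Let m, d, e, k be as in the Gold type code setting, and for 0 ≤ u ≤ k-1 let V_{u,u} ⊆ F_{2^m}^{2u} be the solution set of Σ_{i=1}^{u}(x_{2i-1}x_{2i}^{2^{jd}} + x_{2i-1}^{2^{jd}}x_{2i}) = 0 for j = 1,...,u (with |V_{0,0}| = 1). Then Σ_{a⃗ ∈ F_{2^m}^k} (Σ_{x,y ∈ F_{2^m}} (-1)^{Tr_{F_{2^e}/F_2}(B_{a⃗}(x,y))})^u = 2^{mk} |V_{u,u}|, where B_{a⃗}(x,y) = Σ_{j=1}^{k-1} Tr_{F_{2^m}/F_{2^e}}(a_j(xy^{2^{jd}} + x^{2^{jd}}y)). -/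
open Finset
open scoped Classical

/-- Any finite family in a field with an endomorphism `σ` is annihilated by a monic skew polynomial
in `σ` whose degree is the size of the family. -/
theorem exists_monic_skew_annihilator {K : Type*} [Field K] (σ : K →+* K) {ι : Type*}
    (s : Finset ι) (q : ι → K) :
    ∃ l : ℕ → K, ∀ c ∈ s, σ^[#s] (q c) = ∑ t ∈ range #s, l t * σ^[t] (q c) := by
  induction s using Finset.induction_on with
  | empty => exact ⟨0, by simp⟩
  | insert b s hb ih =>
    obtain ⟨l, hl⟩ := ih
    rw [card_insert_of_notMem hb]
    set v : K := σ^[#s] (q b) - ∑ t ∈ range #s, l t * σ^[t] (q b) with hv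
    set r : K := σ v / v with hr
    have hrv : σ v = r * v := by
      by_cases h : v = 0
      · simp [h]
      · rw [hr, div_mul_cancel₀ _ h]
    -- the skew polynomial `(σ - r) ∘ (σ ^ #s - ∑ l t σ ^ t)`
    refine ⟨fun t ↦ (if t = #s then r else -(r * l t)) + if t = 0 then 0 else σ (l (t - 1)), ?_⟩
    have key (z : K)
        (hz : σ (σ^[#s] z - ∑ t ∈ range #s, l t * σ^[t] z) =
          r * (σ^[#s] z - ∑ t ∈ range #s, l t * σ^[t] z)) :
        σ^[#s + 1] z = ∑ t ∈ range (#s + 1),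
          ((if t = #s then r else -(r * l t)) + if t = 0 then 0 else σ (l (t - 1))) *
            σ^[t] z := by
      simp only [add_mul, sum_add_distrib]
      rw [sum_range_succ, sum_range_succ' (fun t ↦ (if t = 0 then 0 else σ (l (t - 1))) * σ^[t] z)]
      have h1 : ∑ t ∈ range #s, (if t = #s then r else -(r * l t)) * σ^[t] z =
          -(r * ∑ t ∈ range #s, l t * σ^[t] z) := by
        rw [mul_sum, ← sum_neg_distrib]
        refine sum_congr rfl fun t ht ↦ ?_
        rw [if_neg (mem_range.1 ht).ne]
        ring
      simp only [map_sub, map_sum, map_mul, ← Function.iterate_succ_apply'] at hz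
      simp only [h1, if_true, Nat.add_one_ne_zero, if_false, Nat.add_sub_cancel]
      linear_combination hz
    intro c hc
    refine key (q c) ?_
    rcases mem_insert.1 hc with rfl | hc
    · exact hrv
    · rw [hl c hc]
      simp

/-- If `N` consecutive moments `∑ c, p c * σ^[j] (q c)` of a family of size `N` vanish, they all
vanish. -/
theorem sum_mul_iterate_eq_zero {K : Type*} [Field K] (σ : K →+* K) {ι : Type*} [Fintype ι]
    (p q : ι → K) (h : ∀ j < Fintype.card ι, ∑ c, p c * σ^[j] (q c) = 0) (j : ℕ) :
    ∑ c, p c * σ^[j] (q c) = 0 := by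
  obtain ⟨l, hl⟩ := exists_monic_skew_annihilator σ univ q
  rw [card_univ] at hl
  induction j using Nat.strong_induction_on with
  | _ j ih =>
    rcases lt_or_ge j (Fintype.card ι) with hj | hj
    · exact h j hj
    obtain ⟨i, rfl⟩ := Nat.exists_eq_add_of_le' hj
    have hrec (c : ι) : σ^[i + Fintype.card ι] (q c) =
        ∑ t ∈ range (Fintype.card ι), σ^[i] (l t) * σ^[i + t] (q c) := by
      rw [Function.iterate_add_apply, hl c (mem_univ c)]
      simp only [← RingHom.coe_pow, map_sum, map_mul, pow_add, RingHom.mul_def,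
        RingHom.comp_apply]
    simp only [hrec, mul_sum]
    rw [sum_comm]
    refine sum_eq_zero fun t ht ↦ ?_
    have := ih (i + t) (by have := mem_range.1 ht; omega)
    calc _ = σ^[i] (l t) * ∑ c, p c * σ^[i + t] (q c) := by
            rw [mul_sum]
            exact sum_congr rfl fun c _ ↦ by ring
      _ = 0 := by rw [this, mul_zero]

/-- For `u` pairs in a field of characteristic two, the first `u` equations
`∑ i, (x i * σ ^ j (y i) + σ ^ j (x i) * y i) = 0` imply all the others. -/
theorem sum_symplectic_iterate_eq_zero {K : Type*} [Field K] [CharP K 2] (σ : K →+* K) {u : ℕ}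
    (x y : Fin u → K)
    (h : ∀ j ∈ Icc 1 u, ∑ i, (x i * σ^[j] (y i) + σ^[j] (x i) * y i) = 0) (j : ℕ) :
    ∑ i, (x i * σ^[j] (y i) + σ^[j] (x i) * y i) = 0 := by
  have h' (j : ℕ) (hj : j ≤ u) : ∑ i, (x i * σ^[j] (y i) + σ^[j] (x i) * y i) = 0 := by
    rcases Nat.eq_zero_or_pos j with rfl | hj0
    · simp [CharTwo.add_self_eq_zero]
    · exact h j (mem_Icc.2 ⟨hj0, hj⟩)
  -- `σ ^ u` applied to the moments of index `-u, …, u`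
  have hall := sum_mul_iterate_eq_zero σ (Sum.elim (σ^[u] ∘ x) (σ^[u] ∘ y)) (Sum.elim y x) ?_
    (u + j)
  · apply (σ ^ u).injective
    simp only [Fintype.sum_sum_type, Sum.elim_inl, Sum.elim_inr, Function.comp_apply,
      ← sum_add_distrib] at hall
    simp only [map_zero, map_sum, map_add, map_mul, RingHom.coe_pow, ← Function.iterate_add_apply]
    rw [← hall]
    exact sum_congr rfl fun i _ ↦ by ring
  · intro t ht
    simp only [Fintype.card_sum, Fintype.card_fin] at ht
    simp only [Fintype.sum_sum_type, Sum.elim_inl, Sum.elim_inr, Function.comp_apply,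
      ← sum_add_distrib]
    rcases le_total t u with htu | htu
    · obtain ⟨w, rfl⟩ := Nat.exists_eq_add_of_le htu
      have := congrArg (σ ^ t) (h' w (by omega))
      simp only [map_zero, map_sum, map_add, map_mul, RingHom.coe_pow,
        ← Function.iterate_add_apply] at this
      rw [← this]
      exact sum_congr rfl fun i _ ↦ by ring
    · obtain ⟨w, rfl⟩ := Nat.exists_eq_add_of_le htu
      have := congrArg (σ ^ u) (h' w (by omega))
      simp only [map_zero, map_sum, map_add, map_mul, RingHom.coe_pow,
        ← Function.iterate_add_apply] at this
      rw [← this]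
      exact sum_congr rfl fun i _ ↦ by ring

/-- The sign character `z ↦ (-1) ^ Tr (Tr z)` of a tower `K / F / ZMod 2`. -/
noncomputable def traceSignChar (F K : Type*) [Field F] [Field K] [Algebra F K]
    [Algebra (ZMod 2) F] : AddChar K ℤ where
  toFun z := (-1) ^ (Algebra.trace (ZMod 2) F (Algebra.trace F K z)).val
  map_zero_eq_one' := by simp
  map_add_eq_mul' x y := by
    simp only [map_add]
    generalize Algebra.trace (ZMod 2) F (Algebra.trace F K x) = a
    generalize Algebra.trace (ZMod 2) F (Algebra.trace F K y) = b
    revert a b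
    decide

theorem traceSignChar_isPrimitive (F K : Type*) [Field F] [Field K] [Algebra F K] [Finite F]
    [Finite K] [Algebra (ZMod 2) F] : (traceSignChar F K).IsPrimitive := by
  refine AddChar.IsPrimitive.of_ne_one fun h ↦ ?_
  obtain ⟨w, hw⟩ := Algebra.trace_surjective (ZMod 2) F 1
  obtain ⟨z, hz⟩ := Algebra.trace_surjective F K w
  have : traceSignChar F K z = 1 := by rw [h, AddChar.one_apply]
  change (-1 : ℤ) ^ (Algebra.trace (ZMod 2) F (Algebra.trace F K z)).val = 1 at this
  rw [hz, hw] at this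
  exact absurd this (by decide)

theorem AddChar.map_sum_eq_prod {A R ι : Type*} [AddCommMonoid A] [CommMonoid R] (ψ : AddChar A R)
    (s : Finset ι) (f : ι → A) : ψ (∑ i ∈ s, f i) = ∏ i ∈ s, ψ (f i) := by
  induction s using Finset.induction_on with
  | empty => simp
  | insert b s hb ih => rw [sum_insert hb, prod_insert hb, ψ.map_add_eq_mul, ih]

/-- Moments of the exponential sums attached to a linear family of functions: a power sum over the
parameters counts the common zeros. -/
theorem AddChar.IsPrimitive.sum_pow_sum {K R X J : Type*} [CommRing K] [Fintype K] [CommRing R]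
    [IsDomain R] [Fintype X] [Fintype J] [DecidableEq J] {ψ : AddChar K R} (hψ : ψ.IsPrimitive) (g : J → X → K)
    (u : ℕ) :
    ∑ a : J → K, (∑ z, ψ (∑ j, a j * g j z)) ^ u =
      (Fintype.card K : R) ^ Fintype.card J *
        #{p : Fin u → X | ∀ j, ∑ i, g j (p i) = 0} := by
  simp only [Fintype.sum_pow, ← ψ.map_sum_eq_prod]
  rw [sum_comm]
  have hinner (p : Fin u → X) : ∑ a : J → K, ψ (∑ i, ∑ j, a j * g j (p i)) =
      if ∀ j, ∑ i, g j (p i) = 0 then (Fintype.card K : R) ^ Fintype.card J else 0 := by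
    simp only [sum_comm (s := (univ : Finset (Fin u))), ← mul_sum, ψ.map_sum_eq_prod]
    rw [← Fintype.prod_sum fun j t ↦ ψ (t * ∑ i, g j (p i))]
    simp only [AddChar.sum_mulShift _ hψ]
    split_ifs with h
    · simp [h]
    · push Not at h
      obtain ⟨j, hj⟩ := h
      exact prod_eq_zero (mem_univ j) (by simp [hj])
  simp only [hinner]
  rw [← sum_filter, sum_const, nsmul_eq_mul, mul_comm]

/-- Moments of the bilinear-form character sums: for `0 ≤ u ≤ k-1`,
`Σ_{a⃗} (Σ_{x,y} (-1)^{Tr(B_{a⃗}(x,y))})^u = 2^{mk} |V_{u,u}|`, where `V_{u,u}`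
is the solution set of `Σ_{i=1}^u (x_{2i-1}x_{2i}^{2^{jd}} + x_{2i-1}^{2^{jd}}x_{2i}) = 0`
for `j = 1,…,u` (the odd/even entries of the `2u`-tuple being `p.1, p.2`). -/
theorem gold_bilinear_moments (m d e k : ℕ)
    (hm : 0 < m) (hd : 0 < d) (he : 0 < e)
    (he1 : e = Nat.gcd m d) (he2 : e = Nat.gcd m (2 * d))
    (hk1 : 2 ≤ k) (hk2 : k ≤ (m + e) / (2 * e))
    (F K : Type*) [Field F] [Field K] [Algebra F K] [Fintype F] [Fintype K]
    [Algebra (ZMod 2) F]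
    (hF : Fintype.card F = 2 ^ e) (hK : Fintype.card K = 2 ^ m)
    (B : (Fin k → K) → K → K → F)
    (hB : ∀ a x y, B a x y =
      ∑ j ∈ Finset.univ.filter (fun j : Fin k => (j : ℕ) ≠ 0),
        Algebra.trace F K (a j * (x * y ^ (2 ^ ((j : ℕ) * d)) +
          x ^ (2 ^ ((j : ℕ) * d)) * y)))
    (u : ℕ) (hu : u ≤ k - 1) :
    ∑ a : Fin k → K,
        (∑ x : K, ∑ y : K,
          (-1 : ℤ) ^ (Algebra.trace (ZMod 2) F (B a x y)).val) ^ u =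
      2 ^ (m * k) *
        ((Finset.univ.filter (fun p : (Fin u → K) × (Fin u → K) =>
          ∀ j ∈ Finset.Icc 1 u,
            ∑ i : Fin u, (p.1 i * p.2 i ^ (2 ^ (j * d)) +
              p.1 i ^ (2 ^ (j * d)) * p.2 i) = 0)).card : ℤ) := by
  have hchar : CharP K 2 := by
    have : CharP F 2 := charP_of_injective_algebraMap (algebraMap (ZMod 2) F).injective 2
    exact charP_of_injective_algebraMap (algebraMap F K).injective 2
  let g (j : Fin k) (z : K × K) : K := if (j : ℕ) ≠ 0 then
    z.1 * z.2 ^ (2 ^ ((j : ℕ) * d)) + z.1 ^ (2 ^ ((j : ℕ) * d)) * z.2 else 0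
  have hsign (a : Fin k → K) (x y : K) :
      (-1 : ℤ) ^ (Algebra.trace (ZMod 2) F (B a x y)).val =
        traceSignChar F K (∑ j, a j * g j (x, y)) := by
    change _ = (-1 : ℤ) ^ (Algebra.trace (ZMod 2) F (Algebra.trace F K _)).val
    rw [hB, ← map_sum, sum_filter]
    simp only [g, mul_ite, mul_zero]
  have hiter (j : ℕ) (z : K) : (iterateFrobenius K 2 d)^[j] z = z ^ 2 ^ (j * d) := by
    rw [← coe_iterateFrobenius_mul, mul_comm, iterateFrobenius_def]
  simp only [hsign, ← Fintype.sum_prod_type', Prod.mk.eta]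
  rw [(traceSignChar_isPrimitive F K).sum_pow_sum g u, hK, Fintype.card_fin]
  push_cast
  rw [pow_mul]
  congr 2
  refine card_equiv (Equiv.arrowProdEquivProdArrow (Fin u) (fun _ ↦ K) fun _ ↦ K) fun p ↦ ?_
  simp only [mem_filter, mem_univ, true_and, Equiv.arrowProdEquivProdArrow_apply, g]
  constructor
  · intro h j hj
    rw [mem_Icc] at hj
    have := h ⟨j, by omega⟩
    simpa [Nat.one_le_iff_ne_zero.1 hj.1] using this
  · intro h j
    by_cases hj : (j : ℕ) = 0
    · simp [hj]
    · simp only [← hiter] at h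
      have := sum_symplectic_iterate_eq_zero (iterateFrobenius K 2 d) (fun i ↦ (p i).1)
        (fun i ↦ (p i).2) h j
      simpa [hiter, hj] using this
end
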